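/- A peer-to-peer system S is not k-synchronizable if and only if there is a k-synchronizable execution e' of the instrumented system S' that is feasible and bad. -/

import Mathlib

set_option autoImplicit false

/-! ## Actions -/

/-- A send or receive action over processes `P` and messages `M`. -/
inductive Act (P M : Type) : Type
  | send (p q : P) (m : M)
  | recv (p q : P) (m : M)
  deriving DecidableEq

namespace Act
variable {P M : Type}

def isSend : Act P M → Prop
  | send _ _ _ => True
  | recv _ _ _ => False

def isRecv : Act P M → Prop
  | send _ _ _ => False
  | recv _ _ _ => True

/-- The process performing the action: the sender of a send, the receiver of a receive. -/
def proc : Act P M → P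
  | send p _ _ => p
  | recv _ q _ => q

end Act

/-- The two kinds of actions of a message exchange: `S`end and `R`eceive. -/
inductive SR : Type
  | S | R
  deriving DecidableEq

/-- Nodes of conflict graphs with summary nodes: ordinary message exchanges
(identified by the position of their send action), summary nodes `λ_p`, and the node `ψ`. -/
inductive GNode (P : Type) : Type
  | ex (v : ℕ)
  | sum (p : P)
  | psi

/-! ## Matching, message exchanges -/

section Core
variable {P M : Type} [DecidableEq P] [DecidableEq M]

/-- The send at position `i` of `e` is matched by the receive at position `j`:
for some `ℓ`, they are the `ℓ`-th send resp. receive with the given sender/receiver/message. -/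
def Matches (e : List (Act P M)) (i j : ℕ) : Prop :=
  i < j ∧ j < e.length ∧ ∃ p q m,
    e[i]? = some (Act.send p q m) ∧ e[j]? = some (Act.recv p q m) ∧
    (e.take (i + 1)).count (Act.send p q m) = (e.take (j + 1)).count (Act.recv p q m)

/-- Message exchanges (vertices of the conflict graph) are identified with the
positions of their send actions. -/
def IsVertex (e : List (Act P M)) (v : ℕ) : Prop :=
  ∃ p q m, e[v]? = some (Act.send p q m)

def MatchedSend (e : List (Act P M)) (v : ℕ) : Prop := ∃ j, Matches e v j

def UnmatchedSend (e : List (Act P M)) (v : ℕ) : Prop := IsVertex e v ∧ ¬ MatchedSend e v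

def SenderIs (e : List (Act P M)) (v : ℕ) (p : P) : Prop := ∃ q m, e[v]? = some (Act.send p q m)

def ReceiverIs (e : List (Act P M)) (v : ℕ) (q : P) : Prop := ∃ p m, e[v]? = some (Act.send p q m)

/-- A well-formed sequence of actions: every receive is matched. -/
def WFSeq (e : List (Act P M)) : Prop :=
  ∀ j p q m, e[j]? = some (Act.recv p q m) → ∃ i, Matches e i j

end Core

/-! ## MSCs -/

/-- A message sequence chart, presented on `Fin n`. MSCs are identified up to isomorphism. -/
structure MSC (P M : Type) : Type where
  n : ℕ
  label : Fin n → Act P M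
  po : Fin n → Fin n → Prop
  src : Fin n → Fin n → Prop

namespace MSC
variable {P M : Type}

/-- The causality order `≺ = (≺_po ∪ ≺_src)⁺`. -/
def prec (m : MSC P M) : Fin m.n → Fin m.n → Prop :=
  Relation.TransGen (fun i j => m.po i j ∨ m.src i j)

/-- Well-formedness of an MSC: `po` is a strict partial order total on each process's
events, and `src` relates each receive to exactly one send with matching labels,
each send to at most one receive. -/
def WF (m : MSC P M) : Prop :=
  Transitive m.po ∧ (∀ i, ¬ m.po i i) ∧
  (∀ i j, i ≠ j → (m.label i).proc = (m.label j).proc → m.po i j ∨ m.po j i) ∧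
  (∀ r, (m.label r).isRecv → ∃! s, m.src s r) ∧
  (∀ s, (m.label s).isSend → ∀ r r', m.src s r → m.src s r' → r = r') ∧
  (∀ s r, m.src s r → ∃ p q v, m.label s = Act.send p q v ∧ m.label r = Act.recv p q v)

end MSC

section MSCs
variable {P M : Type} [DecidableEq P] [DecidableEq M]

/-- The MSC `msc(e)` of a (well-formed) sequence of actions `e`. -/
def mscOf (e : List (Act P M)) : MSC P M where
  n := e.length
  label i := e.get i
  po i j := (i : ℕ) < (j : ℕ) ∧ (e.get i).proc = (e.get j).proc
  src i j := Matches e i j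

/-- `f` is an isomorphism of MSCs. -/
def IsMSCIso (m₁ m₂ : MSC P M) (f : Fin m₁.n ≃ Fin m₂.n) : Prop :=
  (∀ i, m₂.label (f i) = m₁.label i) ∧
  (∀ i j, m₁.po i j ↔ m₂.po (f i) (f j)) ∧
  (∀ i j, m₁.src i j ↔ m₂.src (f i) (f j))

/-- Isomorphism of MSCs (MSCs are identified up to isomorphism). -/
def MSC.Iso (m₁ m₂ : MSC P M) : Prop := ∃ f, IsMSCIso m₁ m₂ f

/-- `e` is a linearisation of the MSC `m`: `e` is well-formed and `msc(e) = m`. -/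
def Linearisation (e : List (Act P M)) (m : MSC P M) : Prop :=
  WFSeq e ∧ MSC.Iso (mscOf e) m

/-- Causal delivery (mailbox): some linearisation is such that any two causally ordered
sends to a same process are either received in the same order, or the later one is unmatched. -/
def CausalDelivery (m : MSC P M) : Prop :=
  ∃ e : List (Act P M), Linearisation e m ∧
    ∀ (i j : Fin (mscOf e).n) (p p' q : P) (v v' : M),
      (mscOf e).prec i j →
      (mscOf e).label i = Act.send p q v →
      (mscOf e).label j = Act.send p' q v' →
      (¬ MatchedSend e j.val) ∨
        ∃ i' j' : Fin (mscOf e).n,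
          Matches e i.val i'.val ∧ Matches e j.val j'.val ∧ (mscOf e).prec i' j'

/-- Peer-to-peer causal delivery: as causal delivery but only for two sends with the
same sender *and* the same receiver. -/
def P2PCausalDelivery (m : MSC P M) : Prop :=
  ∃ e : List (Act P M), Linearisation e m ∧
    ∀ (i j : Fin (mscOf e).n) (p q : P) (v v' : M),
      (mscOf e).prec i j →
      (mscOf e).label i = Act.send p q v →
      (mscOf e).label j = Act.send p q v' →
      (¬ MatchedSend e j.val) ∨
        ∃ i' j' : Fin (mscOf e).n,
          Matches e i.val i'.val ∧ Matches e j.val j'.val ∧ (mscOf e).prec i' j'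

end MSCs

/-! ## Conflict graphs -/

section CG
variable {P M : Type} [DecidableEq P] [DecidableEq M]

/-- The position of the `X`-action of the message exchange `v`. -/
def XAt (e : List (Act P M)) (v : ℕ) : SR → ℕ → Prop
  | SR.S, i => i = v ∧ IsVertex e v
  | SR.R, i => Matches e v i

/-- The edge `v →_{XY} v'` of the conflict graph of `e`. -/
def CGEdge (e : List (Act P M)) (X Y : SR) (v v' : ℕ) : Prop :=
  ∃ i j, XAt e v X i ∧ XAt e v' Y j ∧ i < j ∧
    ∃ a a' : Act P M, e[i]? = some a ∧ e[j]? = some a' ∧ a.proc = a'.proc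

def CGStep (e : List (Act P M)) (v v' : ℕ) : Prop := ∃ X Y, CGEdge e X Y v v'

/-- Reachability `v →* v'` in the conflict graph. -/
def Reach (e : List (Act P M)) : ℕ → ℕ → Prop := Relation.ReflTransGen (CGStep e)

/-- `U` is a strongly connected component of the conflict graph of `e`. -/
def IsSCC (e : List (Act P M)) (U : Finset ℕ) : Prop :=
  (∀ v ∈ U, IsVertex e v) ∧ ∀ v ∈ U, ∀ v' ∈ U, Reach e v v' ∧ Reach e v' v

/-- Extended edges `v ⊑_{XY} v'` of the extended conflict graph. -/
inductive ExtEdge (e : List (Act P M)) : SR → SR → ℕ → ℕ → Prop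
  | base {X Y : SR} {v v' : ℕ} : CGEdge e X Y v v' → ExtEdge e X Y v v'
  | matched {v : ℕ} : MatchedSend e v → ExtEdge e SR.S SR.R v v
  | rr {v v' : ℕ} : CGEdge e SR.R SR.R v v' → ExtEdge e SR.S SR.S v v'
  | mbox {v v' : ℕ} {q : P} : MatchedSend e v → UnmatchedSend e v' →
      ReceiverIs e v q → ReceiverIs e v' q → ExtEdge e SR.S SR.S v v'
  | trans {X Y Z : SR} {v v' v'' : ℕ} : ExtEdge e X Y v v'' → ExtEdge e Y Z v'' v' →
      ExtEdge e X Z v v'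

/-- The process performing the `X`-action of the exchange `v`. -/
def XProcIs (e : List (Act P M)) (v : ℕ) : SR → P → Prop
  | SR.S, r => SenderIs e v r
  | SR.R, r => ∃ j, Matches e v j ∧ ∃ p m, e[j]? = some (Act.recv p r m)

/-- The set of processes involved in the exchange `v`. -/
def vprocs (e : List (Act P M)) (v : ℕ) : Set P :=
  {r | SenderIs e v r ∨ (MatchedSend e v ∧ ReceiverIs e v r)}

end CG

/-! ## k-exchanges and k-synchronous MSCs -/

section KSync
variable {P M : Type} [DecidableEq P] [DecidableEq M]

/-- A block in `S^{≤k}·R^{≤k}`: at most `k` sends followed by at most `k` receives. -/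
def IsBlock (k : ℕ) (b : List (Act P M)) : Prop :=
  ∃ ss rs : List (Act P M), b = ss ++ rs ∧ (∀ a ∈ ss, a.isSend) ∧ (∀ a ∈ rs, a.isRecv) ∧
    ss.length ≤ k ∧ rs.length ≤ k

def blockStart (es : List (List (Act P M))) (b : ℕ) : ℕ :=
  ((es.take b).map List.length).sum

/-- Positions `i` and `j` of `es.flatten` lie in the same block of `es`. -/
def SameBlock (es : List (List (Act P M))) (i j : ℕ) : Prop :=
  ∃ b, b < es.length ∧ blockStart es b ≤ i ∧ i < blockStart es (b + 1) ∧
    blockStart es b ≤ j ∧ j < blockStart es (b + 1)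

/-- An MSC is `k`-synchronous: it satisfies causal delivery and it has a linearisation
divisible into blocks of `S^{≤k}·R^{≤k}` in which every matched pair lies in one block. -/
def KSyncMSC (k : ℕ) (m : MSC P M) : Prop :=
  CausalDelivery m ∧
  ∃ es : List (List (Act P M)), Linearisation es.flatten m ∧
    (∀ b ∈ es, IsBlock k b) ∧
    ∀ i j, Matches es.flatten i j → SameBlock es i j

/-- A sequence of actions is `k`-synchronizable if its MSC is `k`-synchronous. -/
def KSyncSeq (k : ℕ) (e : List (Act P M)) : Prop := KSyncMSC k (mscOf e)

/-- The peer-to-peer variant of `k`-synchrony. -/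
def P2PKSyncMSC (k : ℕ) (m : MSC P M) : Prop :=
  P2PCausalDelivery m ∧
  ∃ es : List (List (Act P M)), Linearisation es.flatten m ∧
    (∀ b ∈ es, IsBlock k b) ∧
    ∀ i j, Matches es.flatten i j → SameBlock es i j

def P2PKSyncSeq (k : ℕ) (e : List (Act P M)) : Prop := P2PKSyncMSC k (mscOf e)

end KSync

/-! ## Communicating systems (mailbox semantics) -/

/-- A system of communicating finite state machines: a transition relation and an
initial state for each process. -/
structure CSystem (P M St : Type) : Type where
  delta : P → St → Act P M → St → Prop
  init : P → St

section Mailbox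
variable {P M St : Type} [DecidableEq P] [DecidableEq M]

/-- One step of the mailbox semantics on configurations (global state, one buffer per process). -/
inductive MStep (S : CSystem P M St) :
    ((P → St) × (P → List M)) → Act P M → ((P → St) × (P → List M)) → Prop
  | send {l : P → St} {b : P → List M} {p q : P} {m : M} {l' : St} :
      S.delta p (l p) (Act.send p q m) l' →
      MStep S (l, b) (Act.send p q m)
        (Function.update l p l', Function.update b q (b q ++ [m]))
  | recv {l : P → St} {b : P → List M} {p q : P} {m : M} {l' : St} {rest : List M} :
      S.delta q (l q) (Act.recv p q m) l' → b q = m :: rest →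
      MStep S (l, b) (Act.recv p q m)
        (Function.update l q l', Function.update b q rest)

/-- Execution of a sequence of actions between two configurations. -/
inductive ExecFrom (S : CSystem P M St) :
    ((P → St) × (P → List M)) → List (Act P M) → ((P → St) × (P → List M)) → Prop
  | nil {c} : ExecFrom S c [] c
  | cons {c a c' e c''} : MStep S c a c' → ExecFrom S c' e c'' → ExecFrom S c (a :: e) c''

def initConf (S : CSystem P M St) : (P → St) × (P → List M) := (S.init, fun _ => [])

/-- `asEx(S)`: `e` is an (asynchronous) execution of `S`. -/
def asEx (S : CSystem P M St) (e : List (Act P M)) : Prop :=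
  ∃ c, ExecFrom S (initConf S) e c

/-- `S` is `k`-synchronizable: every execution of `S` is `k`-synchronizable. -/
def KSynchronizable (k : ℕ) (S : CSystem P M St) : Prop :=
  ∀ e, asEx S e → KSyncSeq k e

end Mailbox

/-! ## The instrumented system -/

abbrev IProc (P : Type) : Type := Option P
abbrev IMsg (P M : Type) : Type := Sum M (P × M)
abbrev ISt (P M St : Type) : Type := Sum St (Sum (P × M) Bool)
abbrev IAct (P M : Type) : Type := Act (IProc P) (IMsg P M)

def liftAct {P M : Type} : Act P M → IAct P M
  | Act.send p q m => Act.send (some p) (some q) (Sum.inl m)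
  | Act.recv p q m => Act.recv (some p) (some q) (Sum.inl m)

/-- Transitions of the instrumented system `S'`: the original transitions, deviations
of sends/receives through the fresh process `π` (= `none`), and the behaviour of `π`. -/
inductive IDelta {P M St : Type} (S : CSystem P M St) :
    IProc P → ISt P M St → IAct P M → ISt P M St → Prop
  | origSend {p q : P} {m : M} {s s' : St} :
      S.delta p s (Act.send p q m) s' →
      IDelta S (some p) (Sum.inl s) (Act.send (some p) (some q) (Sum.inl m)) (Sum.inl s')
  | origRecv {p q : P} {m : M} {s s' : St} :
      S.delta q s (Act.recv p q m) s' →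
      IDelta S (some q) (Sum.inl s) (Act.recv (some p) (some q) (Sum.inl m)) (Sum.inl s')
  | devSend {p q : P} {m : M} {s s' : St} :
      S.delta p s (Act.send p q m) s' →
      IDelta S (some p) (Sum.inl s) (Act.send (some p) none (Sum.inr (q, m))) (Sum.inl s')
  | devRecv {p q : P} {m : M} {s s' : St} :
      S.delta q s (Act.recv p q m) s' →
      IDelta S (some q) (Sum.inl s) (Act.recv none (some q) (Sum.inl m)) (Sum.inl s')
  | piRecv {p q : P} {m : M} :
      IDelta S none (Sum.inr (Sum.inr false)) (Act.recv (some p) none (Sum.inr (q, m)))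
        (Sum.inr (Sum.inl (q, m)))
  | piSend {q : P} {m : M} :
      IDelta S none (Sum.inr (Sum.inl (q, m))) (Act.send none (some q) (Sum.inl m))
        (Sum.inr (Sum.inr true))

/-- The instrumented system `S'`. -/
def instrumented {P M St : Type} (S : CSystem P M St) :
    CSystem (IProc P) (IMsg P M) (ISt P M St) where
  delta := IDelta S
  init := fun p => match p with
    | some p => Sum.inl (S.init p)
    | none => Sum.inr (Sum.inr false)

section Deviate
variable {P M St : Type} [DecidableEq P] [DecidableEq M]

/-- `e'` is obtained from `ec = e₁·send(p,q,m)·e₂·rec(p,q,m)` (the final receive being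
matched by the exhibited send) by deviating that message exchange through `π`. -/
def Deviate (e' : List (IAct P M)) (ec : List (Act P M)) : Prop :=
  ∃ (e₁ e₂ : List (Act P M)) (p q : P) (m : M),
    ec = e₁ ++ [Act.send p q m] ++ e₂ ++ [Act.recv p q m] ∧
    Matches ec e₁.length (ec.length - 1) ∧
    e' = e₁.map liftAct ++
      [Act.send (some p) none (Sum.inr (q, m)), Act.recv (some p) none (Sum.inr (q, m))] ++
      e₂.map liftAct ++
      [Act.send none (some q) (Sum.inl m), Act.recv none (some q) (Sum.inl m)]

/-- A (k-synchronizable) execution `e'` of `S'` is feasible if it is the deviation of an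
execution of `S`. -/
def Feasible (S : CSystem P M St) (e' : List (IAct P M)) : Prop :=
  ∃ ec, asEx S ec ∧ Deviate e' ec

/-- A feasible execution `e' = deviate(e·r)` is bad if `e·r` is not `k`-synchronizable. -/
def BadExec (k : ℕ) (S : CSystem P M St) (e' : List (IAct P M)) : Prop :=
  ∃ ec, asEx S ec ∧ Deviate e' ec ∧ ¬ KSyncSeq k ec

end Deviate

/-! ## Conflict graphs with summary nodes and the k-exchange transition relation -/

section Summary
variable {P M : Type} [DecidableEq P] [DecidableEq M]

/-- Select by `X ∈ {S,R}` the corresponding component of a pair of sets of processes. -/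
def selC {P : Type} : SR → Set P × Set P → Set P
  | SR.S, c => c.1
  | SR.R, c => c.2

/-- Edges of the conflict graph `CG(e,B,Cπ)` with summary nodes `λ_p` and `ψ`.
(For the graph `CG(e,B)` without `ψ` take `Cπ = (∅,∅)`, which makes `ψ` isolated.) -/
inductive SCGEdge (e : List (Act P M)) (B : P → Set P × Set P) (Cpi : Set P × Set P) :
    SR → SR → GNode P → GNode P → Prop
  | base {X Y : SR} {v v' : ℕ} :
      CGEdge e X Y v v' → SCGEdge e B Cpi X Y (GNode.ex v) (GNode.ex v')
  | sum1 {p : P} {X : SR} {v : ℕ} {r : P} :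
      XProcIs e v X r → r ∈ (B p).1 → SCGEdge e B Cpi SR.S X (GNode.sum p) (GNode.ex v)
  | sum2 {p : P} {X : SR} {v : ℕ} {r : P} :
      XProcIs e v X r → r ∈ (B p).2 → MatchedSend e v →
      SCGEdge e B Cpi SR.S SR.S (GNode.sum p) (GNode.ex v)
  | sum3 {p : P} {v : ℕ} {q : P} :
      ReceiverIs e v q → q ∈ (B p).2 → UnmatchedSend e v →
      SCGEdge e B Cpi SR.S SR.S (GNode.sum p) (GNode.ex v)
  | sum4 {p : P} {v : ℕ} :
      ReceiverIs e v p → MatchedSend e v →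
      SCGEdge e B Cpi SR.S SR.S (GNode.ex v) (GNode.sum p)
  | sum5 {q p : P} :
      p ∈ (B q).2 → SCGEdge e B Cpi SR.S SR.S (GNode.sum q) (GNode.sum p)
  | psi1 {X : SR} {v : ℕ} {r : P} :
      XProcIs e v X r → r ∈ Cpi.1 → SCGEdge e B Cpi SR.S X GNode.psi (GNode.ex v)
  | psi2 {X : SR} {v : ℕ} {r : P} :
      XProcIs e v X r → r ∈ Cpi.2 → MatchedSend e v →
      SCGEdge e B Cpi SR.S SR.S GNode.psi (GNode.ex v)
  | psi3 {v : ℕ} {q : P} :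
      ReceiverIs e v q → q ∈ Cpi.2 → UnmatchedSend e v →
      SCGEdge e B Cpi SR.S SR.S GNode.psi (GNode.ex v)
  | psi4 {p : P} :
      p ∈ Cpi.2 → SCGEdge e B Cpi SR.S SR.S GNode.psi (GNode.sum p)

/-- Extended edges of the conflict graph with summary nodes. -/
inductive SExtEdge (e : List (Act P M)) (B : P → Set P × Set P) (Cpi : Set P × Set P) :
    SR → SR → GNode P → GNode P → Prop
  | base {X Y : SR} {n n' : GNode P} :
      SCGEdge e B Cpi X Y n n' → SExtEdge e B Cpi X Y n n'
  | matched {v : ℕ} :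
      MatchedSend e v → SExtEdge e B Cpi SR.S SR.R (GNode.ex v) (GNode.ex v)
  | rr {n n' : GNode P} :
      SCGEdge e B Cpi SR.R SR.R n n' → SExtEdge e B Cpi SR.S SR.S n n'
  | mbox {v v' : ℕ} {q : P} :
      MatchedSend e v → UnmatchedSend e v' → ReceiverIs e v q → ReceiverIs e v' q →
      SExtEdge e B Cpi SR.S SR.S (GNode.ex v) (GNode.ex v')
  | trans {X Y Z : SR} {n n' n'' : GNode P} :
      SExtEdge e B Cpi X Y n n'' → SExtEdge e B Cpi Y Z n'' n' → SExtEdge e B Cpi X Z n n'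

/-- The nodes `Unm_p`: the summary node `λ_p` together with the unmatched exchanges of `e`
with receiver `p`. -/
def UnmNode (e : List (Act P M)) (p : P) : GNode P → Prop
  | GNode.ex v => UnmatchedSend e v ∧ ReceiverIs e v p
  | GNode.sum q => q = p
  | GNode.psi => False

/-- The updated component `C'_{X,p}` of `B` after the k-exchange `e`. -/
def nextC (e : List (Act P M)) (B : P → Set P × Set P) (X : SR) (p : P) : Set P :=
  selC X (B p)
  ∪ {s | X = SR.S ∧ ∃ v, UnmatchedSend e v ∧ ReceiverIs e v p ∧ SenderIs e v s}
  ∪ {r | ∃ n v', UnmNode e p n ∧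
      SExtEdge e B ((∅, ∅) : Set P × Set P) SR.S SR.S n (GNode.ex v') ∧ XProcIs e v' X r}
  ∪ {r | ∃ q n, ((∃ v, n = GNode.ex v ∧ ReceiverIs e v p) ∨ n = GNode.sum p) ∧
      SExtEdge e B ((∅, ∅) : Set P × Set P) SR.S SR.S n (GNode.sum q) ∧ r ∈ selC X (B q)}

/-- The updated component `C^π_X'` after the k-exchange `e`, where `piP` is the process `π`. -/
def nextCpi (piP : P) (e : List (Act P M)) (B : P → Set P × Set P) (Cpi : Set P × Set P)
    (X : SR) : Set P :=
  selC X Cpi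
  ∪ {s | X = SR.S ∧ ∃ v, ReceiverIs e v piP ∧ SenderIs e v s}
  ∪ {r | ∃ n v', ((∃ v, n = GNode.ex v ∧ ReceiverIs e v piP) ∨ n = GNode.psi) ∧
      SExtEdge e B Cpi SR.S SR.S n (GNode.ex v') ∧ XProcIs e v' X r}
  ∪ {r | ∃ q n, ((∃ v, n = GNode.ex v ∧ ReceiverIs e v piP) ∨ n = GNode.psi) ∧
      SExtEdge e B Cpi SR.S SR.S n (GNode.sum q) ∧ r ∈ selC X (B q)}

end Summary

section KExchange
variable {P M St : Type} [DecidableEq P] [DecidableEq M]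

/-- The transition relation `(l⃗,B) ⇝^e_k (l⃗',B')` on abstract configurations. -/
def KExch (S : CSystem P M St) (k : ℕ) (e : List (Act P M))
    (c c' : (P → St) × (P → Set P × Set P)) : Prop :=
  (∃ ss rs : List (Act P M), e = ss ++ rs ∧ (∀ a ∈ ss, a.isSend) ∧ (∀ a ∈ rs, a.isRecv) ∧
    rs.length ≤ ss.length ∧ ss.length ≤ k) ∧
  (∃ buf, ExecFrom S (c.1, fun _ => []) e (c'.1, buf)) ∧
  (∀ p X, selC X (c'.2 p) = nextC e c.2 X p) ∧
  ∀ p, p ∉ selC SR.R (c'.2 p)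

/-- Iterated `⇝^{e_1}_k ⋯ ⇝^{e_n}_k`. -/
inductive KChain (S : CSystem P M St) (k : ℕ) :
    ((P → St) × (P → Set P × Set P)) → List (List (Act P M)) →
    ((P → St) × (P → Set P × Set P)) → Prop
  | nil {c} : KChain S k c [] c
  | cons {c e c' es c''} :
      KExch S k e c c' → KChain S k c' es c'' → KChain S k c (e :: es) c''

end KExchange

/-! ## The transition relation recognising feasible executions -/

/-- Abstract configurations `(l⃗, B, C⃗^π, dest)` for the instrumented system. -/
structure PiAConf (P M St : Type) : Type where
  gs : IProc P → ISt P M St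
  B : IProc P → Set (IProc P) × Set (IProc P)
  Cpi : Set (IProc P) × Set (IProc P)
  dest : Option P

section PiTrans
variable {P M St : Type} [DecidableEq P] [DecidableEq M]

/-- The transition relation `(l⃗,B,C^π_S,C^π_R,dest) ⇝^e_k (l⃗',B',C^π_S',C^π_R',dest')`. -/
def PiTrans (S : CSystem P M St) (k : ℕ) (e : List (IAct P M))
    (c c' : PiAConf P M St) : Prop :=
  KExch (instrumented S) k e (c.gs, c.B) (c'.gs, c'.B) ∧
  (∀ v, ¬ SenderIs e v (none : IProc P)) ∧
  (∀ v v', ReceiverIs e v (none : IProc P) → ReceiverIs e v' (none : IProc P) →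
    v = v' ∧ c.dest = none) ∧
  ((∃ (d : ℕ) (p q : P) (m : M),
      e[d]? = some (Act.send (some p) none (Sum.inr (q, m))) ∧ c'.dest = some q) ∨
   ((¬ ∃ (d : ℕ) (p q : P) (m : M),
      e[d]? = some (Act.send (some p) none (Sum.inr (q, m)))) ∧ c'.dest = c.dest)) ∧
  (c.dest ≠ none → c'.dest = c.dest) ∧
  (∀ X, selC X c'.Cpi = nextCpi (none : IProc P) e c.B c.Cpi X) ∧
  ∀ q : P, c'.dest = some q → (some q : IProc P) ∉ c'.Cpi.2

inductive PiChain (S : CSystem P M St) (k : ℕ) :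
    PiAConf P M St → List (List (IAct P M)) → PiAConf P M St → Prop
  | nil {c} : PiChain S k c [] c
  | cons {c e c' es c''} :
      PiTrans S k e c c' → PiChain S k c' es c'' → PiChain S k c (e :: es) c''

/-- The initial abstract configuration `(l⃗_0, B_0, (∅,∅), ⊥)`. -/
def initPi (S : CSystem P M St) : PiAConf P M St :=
  ⟨(instrumented S).init, fun _ => (∅, ∅), (∅, ∅), none⟩

end PiTrans

/-! ## The transition relation recognising bad executions -/

/-- Abstract configurations `(P, Q, cnt, sawRS, lastIsRec)`. -/
structure BVConf (P : Type) : Type where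
  Ps : Set P
  Qs : Set P
  cnt : ℕ
  sawRS : Bool
  lir : P → Bool

section BV
variable {P M : Type} [DecidableEq P] [DecidableEq M]

/-- `succ_e(Ps)`: vertices reachable from a vertex involving a process of `Ps`. -/
def succSet (e : List (Act P M)) (Ps : Set P) : Set ℕ :=
  {v | IsVertex e v ∧ ∃ u, IsVertex e u ∧ (∃ r ∈ vprocs e u, r ∈ Ps) ∧ Reach e u v}

/-- `pred_e(Qs)`: vertices co-reachable from a vertex involving a process of `Qs`. -/
def predSet (e : List (Act P M)) (Qs : Set P) : Set ℕ :=
  {v | IsVertex e v ∧ ∃ u, IsVertex e u ∧ (∃ r ∈ vprocs e u, r ∈ Qs) ∧ Reach e v u}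

/-- The transition relation of Fig. 9, `piP` being the process `π`. -/
def BTrans (piP : P) (k : ℕ) (e : List (Act P M)) (c c' : BVConf P) : Prop :=
  c'.Ps = {r | ∃ v ∈ succSet e c.Ps, r ∈ vprocs e v} ∧
  c.Qs = {r | ∃ v ∈ predSet e c'.Qs, r ∈ vprocs e v} ∧
  c'.cnt = min (k + 2) (c.cnt + (succSet e c.Ps ∩ predSet e c'.Qs).ncard) ∧
  (∀ q : P, c'.lir q = true ↔
    ((∃ v ∈ succSet e c.Ps ∩ predSet e c'.Qs, MatchedSend e v ∧ ReceiverIs e v q) ∨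
     (c.lir q = true ∧ ¬ ∃ v, IsVertex e v ∧ SenderIs e v q))) ∧
  (c'.sawRS = true ↔
    (c.sawRS = true ∨ ∃ v ∈ succSet e c.Ps ∩ predSet e c'.Qs, ∃ p : P, p ≠ piP ∧
      SenderIs e v p ∧ c.lir p = true ∧ p ∈ c.Ps ∧ p ∈ c.Qs))

inductive BChain (piP : P) (k : ℕ) :
    BVConf P → List (List (Act P M)) → BVConf P → Prop
  | nil {c} : BChain piP k c [] c
  | cons {c e c' es c''} :
      BTrans piP k e c c' → BChain piP k c' es c'' → BChain piP k c (e :: es) c''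

end BV

/-! ## Peer-to-peer systems -/

section P2P
variable {P M St : Type} [DecidableEq P] [DecidableEq M]

/-- One step of the peer-to-peer semantics (one buffer per ordered pair of processes). -/
inductive P2PStep (S : CSystem P M St) :
    ((P → St) × (P → P → List M)) → Act P M → ((P → St) × (P → P → List M)) → Prop
  | send {l : P → St} {b : P → P → List M} {p q : P} {m : M} {l' : St} :
      S.delta p (l p) (Act.send p q m) l' →
      P2PStep S (l, b) (Act.send p q m)
        (Function.update l p l',
          fun p' q' => if p' = p ∧ q' = q then b p q ++ [m] else b p' q')
  | recv {l : P → St} {b : P → P → List M} {p q : P} {m : M} {l' : St} {rest : List M} :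
      S.delta q (l q) (Act.recv p q m) l' → b p q = m :: rest →
      P2PStep S (l, b) (Act.recv p q m)
        (Function.update l q l',
          fun p' q' => if p' = p ∧ q' = q then rest else b p' q')

inductive P2PExecFrom (S : CSystem P M St) :
    ((P → St) × (P → P → List M)) → List (Act P M) → ((P → St) × (P → P → List M)) → Prop
  | nil {c} : P2PExecFrom S c [] c
  | cons {c a c' e c''} :
      P2PStep S c a c' → P2PExecFrom S c' e c'' → P2PExecFrom S c (a :: e) c''

def p2pInitConf (S : CSystem P M St) : (P → St) × (P → P → List M) :=
  (S.init, fun _ _ => [])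

/-- `e` is a peer-to-peer execution of `S`. -/
def p2pAsEx (S : CSystem P M St) (e : List (Act P M)) : Prop :=
  ∃ c, P2PExecFrom S (p2pInitConf S) e c

/-- `S` is `k`-synchronizable as a peer-to-peer system. -/
def P2PKSynchronizable (k : ℕ) (S : CSystem P M St) : Prop :=
  ∀ e, p2pAsEx S e → P2PKSyncSeq k e

/-- Feasibility for peer-to-peer systems. -/
def P2PFeasible (S : CSystem P M St) (e' : List (IAct P M)) : Prop :=
  ∃ ec, p2pAsEx S ec ∧ Deviate e' ec

/-- Badness for peer-to-peer systems. -/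
def P2PBadExec (k : ℕ) (S : CSystem P M St) (e' : List (IAct P M)) : Prop :=
  ∃ ec, p2pAsEx S ec ∧ Deviate e' ec ∧ ¬ P2PKSyncSeq k ec

/-- The staged update `B_1, …, B_{m+1}` of the forbidden-senders map along `e`. -/
def stageB (e : List (Act P M)) (B : P → Set P) : ℕ → P → Set P
  | 0 => B
  | (i + 1) => fun q =>
      stageB e B i q ∪ {p | ∃ m, e[i]? = some (Act.send p q m) ∧ ¬ MatchedSend e i}

/-- The peer-to-peer transition relation `(l⃗,B) ⇝^e_k (l⃗',B')`. -/
def P2PKExch (S : CSystem P M St) (k : ℕ) (e : List (Act P M))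
    (c c' : (P → St) × (P → Set P)) : Prop :=
  (∃ ss rs : List (Act P M), e = ss ++ rs ∧ (∀ a ∈ ss, a.isSend) ∧ (∀ a ∈ rs, a.isRecv) ∧
    rs.length ≤ ss.length ∧ ss.length ≤ k) ∧
  (∃ buf, P2PExecFrom S (c.1, fun _ _ => []) e (c'.1, buf)) ∧
  c'.2 = stageB e c.2 e.length ∧
  ∀ i p q m, e[i]? = some (Act.send p q m) → MatchedSend e i → p ∉ stageB e c.2 i q

inductive P2PKChain (S : CSystem P M St) (k : ℕ) :
    ((P → St) × (P → Set P)) → List (List (Act P M)) → ((P → St) × (P → Set P)) → Prop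
  | nil {c} : P2PKChain S k c [] c
  | cons {c e c' es c''} :
      P2PKExch S k e c c' → P2PKChain S k c' es c'' → P2PKChain S k c (e :: es) c''

end P2P

/-- Abstract configurations `(l⃗, B, exp, dest)` for the peer-to-peer instrumented system. -/
structure P2PPiConf (P M St : Type) : Type where
  gs : IProc P → ISt P M St
  B : IProc P → Set (IProc P)
  exp : Option P
  dest : Option P

section P2PPi
variable {P M St : Type} [DecidableEq P] [DecidableEq M]

/-- The peer-to-peer transition relation `(l⃗,B,exp,dest) ⇝^e_k (l⃗',B',exp',dest')`. -/
def P2PPiTrans (S : CSystem P M St) (k : ℕ) (e : List (IAct P M))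
    (c c' : P2PPiConf P M St) : Prop :=
  P2PKExch (instrumented S) k e (c.gs, c.B) (c'.gs, c'.B) ∧
  (∀ v, ¬ SenderIs e v (none : IProc P)) ∧
  (∀ v v', ReceiverIs e v (none : IProc P) → ReceiverIs e v' (none : IProc P) →
    v = v' ∧ c.dest = none) ∧
  ((∃ (d : ℕ) (p q : P) (m : M),
      e[d]? = some (Act.send (some p) none (Sum.inr (q, m))) ∧
      c'.exp = some p ∧ c'.dest = some q ∧
      (c.dest = none → ∀ v, d < v → MatchedSend e v →
        ¬ (SenderIs e v (some p) ∧ ReceiverIs e v (some q)))) ∨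
   ((¬ ∃ (d : ℕ) (p q : P) (m : M),
      e[d]? = some (Act.send (some p) none (Sum.inr (q, m)))) ∧
      c'.exp = c.exp ∧ c'.dest = c.dest)) ∧
  (c.dest ≠ none → c'.dest = c.dest ∧ c'.exp = c.exp) ∧
  (∀ p q : P, c'.exp = some p → c'.dest = some q → c.dest ≠ none →
    ∀ v, MatchedSend e v → ¬ (SenderIs e v (some p) ∧ ReceiverIs e v (some q)))

inductive P2PPiChain (S : CSystem P M St) (k : ℕ) :
    P2PPiConf P M St → List (List (IAct P M)) → P2PPiConf P M St → Prop
  | nil {c} : P2PPiChain S k c [] c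
  | cons {c e c' es c''} :
      P2PPiTrans S k e c c' → P2PPiChain S k c' es c'' → P2PPiChain S k c (e :: es) c''

/-- The initial abstract configuration `(l⃗_0, B_0, ⊥, ⊥)`. -/
def initP2PPi (S : CSystem P M St) : P2PPiConf P M St :=
  ⟨(instrumented S).init, fun _ => ∅, none, none⟩

end P2PPi

/-! ## Lists -/

namespace List
variable {α : Type*}

theorem take_succ_eq_of_getElem? {l : List α} {i : ℕ} {a : α} (h : l[i]? = some a) :
    l.take (i + 1) = l.take i ++ [a] := by
  simp [List.take_add_one, h]

theorem eq_take_append_cons_drop {l : List α} {i : ℕ} {a : α} (h : l[i]? = some a) :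
    l = l.take i ++ a :: l.drop (i + 1) := by
  obtain ⟨hi, rfl⟩ := List.getElem?_eq_some_iff.1 h
  simp

theorem eq_append_cons_of_filter_eq {f : α → Bool} {l A B : List α} {a : α}
    (h : l.filter f = A ++ a :: B) :
    ∃ l₁ l₂, l = l₁ ++ a :: l₂ ∧ l₁.filter f = A ∧ l₂.filter f = B := by
  obtain ⟨l₁, l₂, rfl, h₁, h₂⟩ := List.filter_eq_append_iff.1 h
  obtain ⟨m₁, m₂, rfl, h₃, _, h₄⟩ := List.filter_eq_cons_iff.1 h₂
  refine ⟨l₁ ++ m₁, m₂, by simp, ?_, h₄⟩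
  rw [List.filter_append, h₁, List.filter_eq_nil_iff.2 h₃, List.append_nil]

variable [DecidableEq α]

/-- Every value between `1` and the number of occurrences of `a` is the rank of an occurrence. -/
theorem exists_getElem?_count_take_eq {l : List α} {a : α} {c : ℕ} (h₁ : 1 ≤ c)
    (h₂ : c ≤ l.count a) : ∃ i, l[i]? = some a ∧ (l.take (i + 1)).count a = c := by
  induction l using List.reverseRecOn with
  | nil => simp at h₂; omega
  | append_singleton l b ih =>
    by_cases h : c ≤ l.count a
    · obtain ⟨i, hi, hc⟩ := ih h
      have hl : i < l.length := (List.getElem?_eq_some_iff.1 hi).1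
      refine ⟨i, by rw [List.getElem?_append_left hl, hi], ?_⟩
      rw [List.take_append_of_le_length (by omega), hc]
    · by_cases hb : b = a
      · subst hb
        refine ⟨l.length, by simp, ?_⟩
        rw [List.take_of_length_le (by simp)]
        simp only [List.count_append, List.count_singleton_self] at h₂ ⊢
        omega
      · simp [List.count_append, hb] at h₂
        omega

theorem count_take_lt_of_getElem? {l : List α} {a : α} {i j : ℕ} (hj : l[j]? = some a)
    (h : i < j) : (l.take (i + 1)).count a < (l.take (j + 1)).count a := by
  rw [List.take_succ_eq_of_getElem? hj, List.count_append, List.count_singleton_self]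
  have : (l.take (i + 1)).count a ≤ (l.take j).count a :=
    (List.take_prefix_take_left (by omega)).sublist.count_le a
  omega

theorem eq_of_count_take_eq {l : List α} {a : α} {i j : ℕ} (hi : l[i]? = some a)
    (hj : l[j]? = some a) (h : (l.take (i + 1)).count a = (l.take (j + 1)).count a) : i = j := by
  rcases lt_trichotomy i j with hij | hij | hij
  · have := List.count_take_lt_of_getElem? hj hij
    omega
  · exact hij
  · have := List.count_take_lt_of_getElem? hi hij
    omega

theorem concat_eq_concat_of_prefix_of_count_eq {x y l : List α} {a : α} (hx : x ++ [a] <+: l)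
    (hy : y ++ [a] <+: l) (h : (x ++ [a]).count a = (y ++ [a]).count a) : x = y := by
  have key : ∀ {x y : List α}, x ++ [a] <+: y ++ [a] →
      (x ++ [a]).count a = (y ++ [a]).count a → x = y := by
    intro x y hp hc
    rcases List.prefix_concat_iff.1 hp with h' | h'
    · simpa using h'
    · have := h'.sublist.count_le a
      simp at hc this
      omega
  rcases List.prefix_or_prefix_of_prefix hx hy with h' | h'
  · exact key h' h
  · exact (key h' h.symm).symm

end List

/-! ## Projections and MSC isomorphisms -/

section Projections
variable {P M : Type} [DecidableEq P]

/-- The actions of `e` performed by `p`. -/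
def procProj (p : P) (e : List (Act P M)) : List (Act P M) := e.filter (fun a => a.proc = p)

theorem procProj_append (p : P) (x y : List (Act P M)) :
    procProj p (x ++ y) = procProj p x ++ procProj p y := List.filter_append ..

theorem procProj_cons_send (r p q : P) (m : M) (x : List (Act P M)) :
    procProj r (Act.send p q m :: x) =
      if p = r then Act.send p q m :: procProj r x else procProj r x := by
  by_cases h : p = r <;> simp [procProj, Act.proc, h]

theorem procProj_cons_recv (r p q : P) (m : M) (x : List (Act P M)) :
    procProj r (Act.recv p q m :: x) =
      if q = r then Act.recv p q m :: procProj r x else procProj r x := by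
  by_cases h : q = r <;> simp [procProj, Act.proc, h]

@[simp] theorem procProj_nil (p : P) : procProj p ([] : List (Act P M)) = [] := rfl

/-- The number of actions of the same process strictly before position `i`. -/
def procRank (e : List (Act P M)) (i : Fin e.length) : ℕ :=
  (procProj (e.get i).proc (e.take i)).length

omit [DecidableEq P] in
theorem getElem?_get (e : List (Act P M)) (i : Fin e.length) : e[(i : ℕ)]? = some (e.get i) := by
  simp

theorem procProj_take_succ (e : List (Act P M)) (i : Fin e.length) :
    procProj (e.get i).proc (e.take (i + 1)) =
      procProj (e.get i).proc (e.take i) ++ [e.get i] := by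
  rw [List.take_succ_eq_of_getElem? (getElem?_get e i), procProj_append]
  simp [procProj]

theorem procProj_take_eq (e : List (Act P M)) (i : Fin e.length) :
    procProj (e.get i).proc (e.take (i + 1)) =
      (procProj (e.get i).proc e).take (procRank e i + 1) := by
  have h : procProj (e.get i).proc e = procProj (e.get i).proc (e.take (i + 1)) ++
      procProj (e.get i).proc (e.drop (i + 1)) := by
    rw [← procProj_append, List.take_append_drop]
  rw [h, List.take_left']
  rw [procProj_take_succ]
  simp [procRank]

theorem procProj_getElem?_procRank (e : List (Act P M)) (i : Fin e.length) :
    (procProj (e.get i).proc e)[procRank e i]? = some (e.get i) := by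
  have h := congrArg (fun l => l[procRank e i]?) (procProj_take_eq e i)
  simp only [procProj_take_succ] at h
  rw [List.getElem?_take_of_lt (by omega)] at h
  rw [← h]
  simp [procRank]

theorem procRank_lt (e : List (Act P M)) {i j : Fin e.length} (h : i < j)
    (hp : (e.get i).proc = (e.get j).proc) : procRank e i < procRank e j := by
  have h₁ : (procProj (e.get i).proc (e.take (i + 1))).length ≤
      (procProj (e.get i).proc (e.take j)).length :=
    ((List.take_prefix_take_left (l := e) (by simpa using h)).filter _).length_le
  rw [procProj_take_succ] at h₁
  simp only [procRank, ← hp]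
  simp at h₁ ⊢
  omega

theorem procRank_lt_iff (e : List (Act P M)) {i j : Fin e.length}
    (hp : (e.get i).proc = (e.get j).proc) : procRank e i < procRank e j ↔ i < j := by
  refine ⟨fun h => ?_, fun h => procRank_lt e h hp⟩
  rcases lt_trichotomy i j with h' | h' | h'
  · exact h'
  · subst h'; omega
  · have := procRank_lt e h' hp.symm; omega

/-- An event is determined by its process and its rank. -/
def procCoord (e : List (Act P M)) (i : Fin e.length) : P × ℕ := ((e.get i).proc, procRank e i)

theorem procCoord_injective (e : List (Act P M)) : Function.Injective (procCoord e) := by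
  intro i j h
  obtain ⟨h₁, h₂⟩ := Prod.mk.inj h
  rcases lt_trichotomy i j with h' | h' | h'
  · have := procRank_lt e h' h₁; omega
  · exact h'
  · have := procRank_lt e h' h₁.symm; omega

theorem range_procCoord (e : List (Act P M)) :
    Set.range (procCoord e) = {x | x.2 < (procProj x.1 e).length} := by
  ext ⟨p, n⟩
  constructor
  · rintro ⟨i, hi⟩
    obtain ⟨rfl, rfl⟩ := Prod.mk.inj hi
    exact (List.getElem?_eq_some_iff.1 (procProj_getElem?_procRank e i)).1
  · intro (h : n < (procProj p e).length)
    have ha : (procProj p e)[n]? = some ((procProj p e)[n]) := List.getElem?_eq_getElem h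
    have hp : ((procProj p e)[n]).proc = p := by
      simpa using (List.mem_filter.1 (List.getElem_mem h)).2
    generalize (procProj p e)[n] = a at ha hp
    obtain ⟨l₁, l₂, rfl, h₁, h₂⟩ :=
      List.eq_append_cons_of_filter_eq (List.eq_take_append_cons_drop ha)
    refine ⟨⟨l₁.length, by simp⟩, ?_⟩
    subst hp
    have hn := (List.getElem?_eq_some_iff.1 ha).1
    simp only [procCoord, procRank, procProj, List.get_eq_getElem, List.getElem_append_right,
      List.take_left', le_refl, Nat.sub_self, List.getElem_cons_zero, h₁] at hn ⊢
    simp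
    simp at hn
    omega

variable [DecidableEq M]

theorem count_procProj (a : Act P M) (x : List (Act P M)) :
    (procProj a.proc x).count a = x.count a := by
  rw [procProj, List.count_filter]
  simp

theorem count_take_eq_procRank (e : List (Act P M)) (i : Fin e.length) :
    (e.take (i + 1)).count (e.get i) =
      ((procProj (e.get i).proc e).take (procRank e i + 1)).count (e.get i) := by
  rw [← count_procProj, procProj_take_eq]

theorem count_eq_of_procProj_eq {e f : List (Act P M)} {a : Act P M}
    (h : procProj a.proc e = procProj a.proc f) : e.count a = f.count a := by
  rw [← count_procProj, h, count_procProj]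

/-- Well-formed sequences with the same projections have the same matching. -/
theorem Matches.of_procRank_eq {e f : List (Act P M)} (hf : WFSeq f)
    (h : ∀ p, procProj p e = procProj p f) {i j : Fin e.length} {i' j' : Fin f.length}
    (hi : f.get i' = e.get i) (hj : f.get j' = e.get j)
    (hi' : procRank f i' = procRank e i) (hj' : procRank f j' = procRank e j)
    (hm : Matches e i j) : Matches f i' j' := by
  obtain ⟨-, -, p, q, m, hs, hr, hc⟩ := hm
  simp only [getElem?_get, Option.some.injEq] at hs hr
  obtain ⟨l, hl⟩ := hf j' p q m (by rw [getElem?_get, hj, hr])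
  have hl' := hl
  obtain ⟨hlt, hlen, p', q', m', hs', hr', hc'⟩ := hl
  rw [getElem?_get, hj, hr, Option.some.injEq] at hr'
  injection hr' with e₁ e₂ e₃
  subst e₁ e₂ e₃
  have key : l = i' := by
    refine List.eq_of_count_take_eq hs' (by rw [getElem?_get, hi, hs]) ?_
    rw [hc']
    have e₁ := count_take_eq_procRank e i
    have e₂ := count_take_eq_procRank f i'
    have e₃ := count_take_eq_procRank e j
    have e₄ := count_take_eq_procRank f j'
    rw [hi, hi', ← h, ← e₁, hs] at e₂
    rw [hj, hj', ← h, ← e₃, hr] at e₄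
    rw [e₂, e₄, hc]
  rwa [← key]

theorem mscIso_of_procProj_eq {e f : List (Act P M)} (he : WFSeq e) (hf : WFSeq f)
    (h : ∀ p, procProj p e = procProj p f) : MSC.Iso (mscOf e) (mscOf f) := by
  have hr : Set.range (procCoord e) = Set.range (procCoord f) := by
    simp only [range_procCoord, h]
  let g : Fin e.length ≃ Fin f.length :=
    ((Equiv.ofInjective _ (procCoord_injective e)).trans (Equiv.setCongr hr)).trans
      (Equiv.ofInjective _ (procCoord_injective f)).symm
  have hg : ∀ i, procCoord f (g i) = procCoord e i := fun i => by
    have := Equiv.apply_ofInjective_symm (procCoord_injective f)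
      (Equiv.setCongr hr (Equiv.ofInjective _ (procCoord_injective e) i))
    simpa [g] using this
  have hproc : ∀ i, (f.get (g i)).proc = (e.get i).proc := fun i => congrArg Prod.fst (hg i)
  have hrank : ∀ i, procRank f (g i) = procRank e i := fun i => congrArg Prod.snd (hg i)
  have hlab : ∀ i, f.get (g i) = e.get i := fun i => by
    have h₁ := procProj_getElem?_procRank e i
    have h₂ := procProj_getElem?_procRank f (g i)
    rw [hproc, hrank, ← h, h₁] at h₂
    exact (Option.some.inj h₂).symm
  have hpo : ∀ i j : Fin e.length, (i < j ∧ (e.get i).proc = (e.get j).proc) ↔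
      (g i < g j ∧ (f.get (g i)).proc = (f.get (g j)).proc) := fun i j => by
    rw [hproc, hproc]
    refine and_congr_left fun hp => ?_
    rw [← procRank_lt_iff e hp, ← procRank_lt_iff f (by rw [hproc, hproc, hp]), hrank, hrank]
  refine ⟨g, hlab, hpo, fun i j => ⟨fun hm => ?_, fun hm => ?_⟩⟩
  · exact hm.of_procRank_eq hf h (hlab i) (hlab j) (hrank i) (hrank j)
  · exact Matches.of_procRank_eq he (fun p => (h p).symm) (hlab i).symm (hlab j).symm
      (hrank i).symm (hrank j).symm hm

omit [DecidableEq M] in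
theorem procProj_eq_map_finRange (p : P) (e : List (Act P M)) :
    procProj p e = ((List.finRange e.length).filter (fun i => (e.get i).proc = p)).map e.get := by
  conv_lhs => rw [procProj, ← List.map_get_finRange e, List.filter_map]
  rfl

theorem procProj_eq_of_mscIso {e f : List (Act P M)} (h : MSC.Iso (mscOf e) (mscOf f)) (p : P) :
    procProj p e = procProj p f := by
  obtain ⟨g, hlab, hpo, -⟩ := h
  change Fin e.length ≃ Fin f.length at g
  replace hlab : ∀ i : Fin e.length, f.get (g i) = e.get i := hlab
  replace hpo : ∀ i j : Fin e.length, (i < j ∧ (e.get i).proc = (e.get j).proc) ↔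
    (g i < g j ∧ (f.get (g i)).proc = (f.get (g j)).proc) := hpo
  have hsorted : ∀ x : List (Act P M), ((List.finRange x.length).filter
      (fun i => (x.get i).proc = p)).Pairwise (· < ·) := fun x =>
    (List.pairwise_lt_finRange _).filter _
  have key : ((List.finRange e.length).filter (fun i => (e.get i).proc = p)).map g =
      (List.finRange f.length).filter (fun i => (f.get i).proc = p) := by
    refine List.Perm.eq_of_pairwise (le := (· < ·)) (fun a b _ _ h₁ h₂ => absurd h₂ h₁.asymm)
      ?_ (hsorted f) ?_
    · rw [List.pairwise_map]
      refine (hsorted e).imp_of_mem ?_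
      intro a b ha hb hab
      have ha' := (List.mem_filter.1 ha).2
      have hb' := (List.mem_filter.1 hb).2
      simp only [decide_eq_true_eq] at ha' hb'
      exact ((hpo a b).1 ⟨hab, by rw [ha', hb']⟩).1
    · refine (List.perm_ext_iff_of_nodup ?_ ?_).2 fun a => ?_
      · exact ((List.nodup_finRange _).filter _).map g.injective
      · exact (List.nodup_finRange _).filter _
      · simp only [List.mem_map, List.mem_filter, List.mem_finRange, true_and, decide_eq_true_eq]
        constructor
        · rintro ⟨i, hi, rfl⟩
          rw [hlab, hi]
        · intro ha
          exact ⟨g.symm a, by rw [← hlab, g.apply_symm_apply, ha], g.apply_symm_apply a⟩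
  rw [procProj_eq_map_finRange, procProj_eq_map_finRange, ← key, List.map_map]
  exact List.map_congr_left fun i _ => (hlab i).symm

end Projections

/-! ## Matching in terms of counting -/

section Counting
variable {P M : Type} [DecidableEq P] [DecidableEq M]

/-- In every prefix, each message is received at most as often as it is sent. -/
def PrefixBalanced (e : List (Act P M)) : Prop :=
  ∀ x, x <+: e → ∀ p q m, x.count (Act.recv p q m) ≤ x.count (Act.send p q m)

theorem WFSeq.prefixBalanced {e : List (Act P M)} (h : WFSeq e) : PrefixBalanced e := by
  intro x hx p q m
  induction x using List.reverseRecOn with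
  | nil => simp
  | append_singleton x a ih =>
    by_cases ha : a = Act.recv p q m
    · subst ha
      have hx' : e.take (x.length + 1) = x ++ [Act.recv p q m] := by
        rw [List.prefix_iff_eq_take.1 hx]
        simp
      have hj : e[x.length]? = some (Act.recv p q m) := by
        obtain ⟨t, rfl⟩ := hx
        simp
      obtain ⟨i, hlt, -, p', q', m', hs, hr, hc⟩ := h _ p q m hj
      rw [hj, Option.some.injEq] at hr
      injection hr with e₁ e₂ e₃
      subst e₁ e₂ e₃
      rw [← hx', ← hc]
      exact (List.take_prefix_take_left (by omega)).sublist.count_le _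
    · have := ih ((List.prefix_append x [a]).trans hx)
      rw [List.count_append, List.count_append, List.count_singleton]
      simp [ha]
      omega

theorem PrefixBalanced.wfSeq {e : List (Act P M)} (h : PrefixBalanced e) : WFSeq e := by
  intro j p q m hj
  have hlen := (List.getElem?_eq_some_iff.1 hj).1
  obtain ⟨i, hi, hc⟩ := List.exists_getElem?_count_take_eq
    (l := e.take (j + 1)) (a := Act.send p q m)
    (c := (e.take (j + 1)).count (Act.recv p q m))
    (by rw [List.take_succ_eq_of_getElem? hj]; simp) (h _ (List.take_prefix _ _) p q m)
  have hi' := (List.getElem?_eq_some_iff.1 hi).1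
  rw [List.length_take] at hi'
  rw [List.getElem?_take_of_lt (by omega)] at hi
  rw [List.take_take, min_eq_left (by omega)] at hc
  refine ⟨i, ?_, hlen, p, q, m, hi, hj, hc⟩
  rcases Nat.lt_or_ge i j with hij | hij
  · exact hij
  · obtain rfl : i = j := by omega
    rw [hi] at hj
    cases hj

/-- Block prefixes are balanced, and a message left unreceived at the end of a block is never
received later: no matched pair crosses a block boundary. -/
def BlockBalanced (es : List (List (Act P M))) : Prop :=
  ∀ A B, es = A ++ B → ∀ p q m,
    A.flatten.count (Act.recv p q m) ≤ A.flatten.count (Act.send p q m) ∧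
    (A.flatten.count (Act.recv p q m) = A.flatten.count (Act.send p q m) ∨
      B.flatten.count (Act.recv p q m) = 0)

omit [DecidableEq P] [DecidableEq M] in
theorem blockStart_mono (es : List (List (Act P M))) : Monotone (blockStart es) := by
  intro a b h
  exact ((List.take_prefix_take_left (l := es) h).map List.length).sublist.sum_le_sum
    (fun _ _ => Nat.zero_le _)

omit [DecidableEq P] [DecidableEq M] in
theorem blockStart_length_append (A B : List (List (Act P M))) :
    blockStart (A ++ B) A.length = A.flatten.length := by
  simp [blockStart, List.length_flatten]

omit [DecidableEq P] [DecidableEq M] in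
theorem exists_block_of_lt (es : List (List (Act P M))) {j n : ℕ} (h : j < blockStart es n) :
    ∃ b < n, blockStart es b ≤ j ∧ j < blockStart es (b + 1) := by
  induction n with
  | zero => simp [blockStart] at h
  | succ n ih =>
    by_cases hn : j < blockStart es n
    · obtain ⟨b, hb, h'⟩ := ih hn
      exact ⟨b, by omega, h'⟩
    · exact ⟨n, by omega, by omega, h⟩

theorem blockBalanced_of_sameBlock {es : List (List (Act P M))} (hwf : WFSeq es.flatten)
    (h : ∀ i j, Matches es.flatten i j → SameBlock es i j) : BlockBalanced es := by
  rintro A B rfl p q m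
  have hbal := hwf.prefixBalanced
  rw [List.flatten_append] at hbal h
  have hA := hbal _ (List.prefix_append _ _) p q m
  refine ⟨hA, ?_⟩
  by_contra! hne
  obtain ⟨hne, hB⟩ := hne
  obtain ⟨i, hi, hci⟩ := List.exists_getElem?_count_take_eq
    (l := A.flatten) (a := Act.send p q m)
    (c := A.flatten.count (Act.recv p q m) + 1) (by omega) (by omega)
  obtain ⟨j, hj, hcj⟩ := List.exists_getElem?_count_take_eq
    (l := A.flatten ++ B.flatten) (a := Act.recv p q m)
    (c := A.flatten.count (Act.recv p q m) + 1) (by omega)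
    (by rw [List.count_append]; omega)
  have hilt := (List.getElem?_eq_some_iff.1 hi).1
  have hjlt := (List.getElem?_eq_some_iff.1 hj).1
  have hjge : A.flatten.length ≤ j := by
    by_contra hlt
    rw [List.take_append_of_le_length (by omega)] at hcj
    have := (List.take_prefix (j + 1) A.flatten).sublist.count_le (Act.recv p q m)
    omega
  obtain ⟨b, -, h₁, h₂, h₃, h₄⟩ := h i j ⟨by omega, hjlt, p, q, m,
    by rw [List.getElem?_append_left hilt, hi], hj,
    by rw [List.take_append_of_le_length (by omega), hci, hcj]⟩
  have hs := blockStart_length_append A B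
  rcases Nat.lt_or_ge b A.length with hb | hb
  · have := blockStart_mono (A ++ B) (show b + 1 ≤ A.length from hb)
    omega
  · have := blockStart_mono (A ++ B) hb
    omega

theorem BlockBalanced.sameBlock {es : List (List (Act P M))} (h : BlockBalanced es) {i j : ℕ}
    (hm : Matches es.flatten i j) : SameBlock es i j := by
  obtain ⟨hij, hj, p, q, m, hsi, hrj, hc⟩ := hm
  have hj' : j < blockStart es es.length := by
    simpa [blockStart, List.length_flatten] using hj
  obtain ⟨b, hb, h₁, h₂⟩ := exists_block_of_lt es hj'
  refine ⟨b, hb, ?_, by omega, h₁, h₂⟩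
  by_contra hi
  obtain ⟨-, hcr⟩ := h (es.take b) (es.drop b) (List.take_append_drop b es).symm p q m
  have hs : (es.take b).flatten.length = blockStart es b := by
    simp [blockStart, List.length_flatten]
  have hflat : es.flatten = (es.take b).flatten ++ (es.drop b).flatten := by
    rw [← List.flatten_append, List.take_append_drop]
  generalize (es.take b).flatten = X at *
  generalize (es.drop b).flatten = Y at *
  rw [hflat] at hc hrj hsi
  rw [List.take_append_of_le_length (by omega)] at hc
  have h₃ := (List.take_prefix (i + 1) X).sublist.count_le (Act.send p q m)
  have h₄ := List.take_succ_eq_of_getElem? hrj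
  have h₅ : X.count (Act.recv p q m) ≤ ((X ++ Y).take j).count (Act.recv p q m) :=
    List.Sublist.count_le _ (List.IsPrefix.sublist
      (by rw [List.take_append, List.take_of_length_le (by omega)]; exact List.prefix_append _ _))
  have h₆ := (List.take_prefix (j + 1) (X ++ Y)).sublist.count_le (Act.recv p q m)
  rw [List.count_append] at h₆
  rw [h₄, List.count_append, List.count_singleton_self] at hc h₆
  omega

theorem count_send_eq_zero_of_isRecv {l : List (Act P M)} (h : ∀ a ∈ l, a.isRecv) (p q : P)
    (m : M) : l.count (Act.send p q m) = 0 :=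
  List.count_eq_zero.2 fun hm => h _ hm

theorem count_recv_eq_zero_of_isSend {l : List (Act P M)} (h : ∀ a ∈ l, a.isSend) (p q : P)
    (m : M) : l.count (Act.recv p q m) = 0 :=
  List.count_eq_zero.2 fun hm => h _ hm

theorem BlockBalanced.prefixBalanced {k : ℕ} {es : List (List (Act P M))} (h : BlockBalanced es)
    (hb : ∀ b ∈ es, IsBlock k b) : PrefixBalanced es.flatten := by
  rintro x ⟨y, hy⟩ p q m
  rcases List.flatten_eq_append_iff.1 hy.symm with
    ⟨A, B, rfl, rfl, -⟩ | ⟨A, b₁, c, b₂, B, rfl, rfl, -⟩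
  · exact (h A B rfl p q m).1
  · obtain ⟨ss, rs, hsr, hss, hrs, -, -⟩ := hb (b₁ ++ c :: b₂) (by simp)
    have hA := (h A _ rfl p q m).1
    have hA' := (h (A ++ [b₁ ++ c :: b₂]) B (by simp) p q m).1
    simp only [List.flatten_append, List.flatten_cons, List.flatten_nil, List.append_nil] at hA'
    rw [List.count_append, List.count_append] at hA' ⊢
    rcases List.append_eq_append_iff.1 hsr with ⟨t, rfl, -⟩ | ⟨t, rfl, rfl⟩
    · have := count_recv_eq_zero_of_isSend (l := b₁)
        (fun a ha => hss a (List.mem_append_left _ ha)) p q m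
      omega
    · have h₁ := count_send_eq_zero_of_isRecv (l := c :: b₂)
        (fun a ha => hrs a (List.mem_append_right _ ha)) p q m
      simp only [List.count_append, h₁] at hA' ⊢
      omega

theorem p2pKSyncSeq_iff {k : ℕ} {e : List (Act P M)} (hwf : WFSeq e)
    (hcd : P2PCausalDelivery (mscOf e)) :
    P2PKSyncSeq k e ↔ ∃ es : List (List (Act P M)), (∀ b ∈ es, IsBlock k b) ∧
      BlockBalanced es ∧ ∀ p, procProj p es.flatten = procProj p e := by
  constructor
  · rintro ⟨-, es, ⟨hes, hiso⟩, hb, hm⟩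
    exact ⟨es, hb, blockBalanced_of_sameBlock hes hm, procProj_eq_of_mscIso hiso⟩
  · rintro ⟨es, hb, hbal, hp⟩
    have hes := (hbal.prefixBalanced hb).wfSeq
    exact ⟨hcd, es, ⟨hes, mscIso_of_procProj_eq hes hwf hp⟩, hb, fun _ _ => hbal.sameBlock⟩

end Counting

/-! ## Peer-to-peer executions as FIFO local runs -/

section Channels
variable {P M St : Type} [DecidableEq P] [DecidableEq M]

/-- The messages sent on the channel from `p` to `q`. -/
def sentOn (p q : P) (e : List (Act P M)) : List M :=
  e.filterMap fun a => match a with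
    | Act.send p' q' m => if p' = p ∧ q' = q then some m else none
    | Act.recv _ _ _ => none

/-- The messages received on the channel from `p` to `q`. -/
def receivedOn (p q : P) (e : List (Act P M)) : List M :=
  e.filterMap fun a => match a with
    | Act.send _ _ _ => none
    | Act.recv p' q' m => if p' = p ∧ q' = q then some m else none

/-- On each channel and in each prefix, the received messages are the first sent ones. -/
def IsFIFO (e : List (Act P M)) : Prop :=
  ∀ x, x <+: e → ∀ p q, receivedOn p q x <+: sentOn p q x

/-- Runs of the local automata, without any constraint on buffers. -/
inductive LocalRun (S : CSystem P M St) : (P → St) → List (Act P M) → (P → St) → Prop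
  | nil {l : P → St} : LocalRun S l [] l
  | cons {l l'' : P → St} {a : Act P M} {s : St} {e : List (Act P M)} :
      S.delta a.proc (l a.proc) a s → LocalRun S (Function.update l a.proc s) e l'' →
      LocalRun S l (a :: e) l''

omit [DecidableEq M] in
@[simp] theorem sentOn_append (p q : P) (x y : List (Act P M)) :
    sentOn p q (x ++ y) = sentOn p q x ++ sentOn p q y := List.filterMap_append

omit [DecidableEq M] in
@[simp] theorem receivedOn_append (p q : P) (x y : List (Act P M)) :
    receivedOn p q (x ++ y) = receivedOn p q x ++ receivedOn p q y := List.filterMap_append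

omit [DecidableEq M] in
@[simp] theorem sentOn_nil (p q : P) : sentOn p q ([] : List (Act P M)) = [] := rfl

omit [DecidableEq M] in
@[simp] theorem receivedOn_nil (p q : P) : receivedOn p q ([] : List (Act P M)) = [] := rfl

omit [DecidableEq M] in
@[simp] theorem sentOn_cons_send (p q p' q' : P) (m : M) (x : List (Act P M)) :
    sentOn p q (Act.send p' q' m :: x) =
      if p' = p ∧ q' = q then m :: sentOn p q x else sentOn p q x := by
  split_ifs with h <;> simp [sentOn, h]

omit [DecidableEq M] in
@[simp] theorem sentOn_cons_recv (p q p' q' : P) (m : M) (x : List (Act P M)) :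
    sentOn p q (Act.recv p' q' m :: x) = sentOn p q x := by
  simp [sentOn]

omit [DecidableEq M] in
@[simp] theorem receivedOn_cons_send (p q p' q' : P) (m : M) (x : List (Act P M)) :
    receivedOn p q (Act.send p' q' m :: x) = receivedOn p q x := by
  simp [receivedOn]

omit [DecidableEq M] in
@[simp] theorem receivedOn_cons_recv (p q p' q' : P) (m : M) (x : List (Act P M)) :
    receivedOn p q (Act.recv p' q' m :: x) =
      if p' = p ∧ q' = q then m :: receivedOn p q x else receivedOn p q x := by
  split_ifs with h <;> simp [receivedOn, h]

theorem count_sentOn (p q : P) (m : M) (e : List (Act P M)) :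
    (sentOn p q e).count m = e.count (Act.send p q m) := by
  induction e with
  | nil => rfl
  | cons a e ih =>
    cases a with
    | send p' q' m' =>
      by_cases h : Act.send p' q' m' = Act.send p q m
      · injection h with h₁ h₂ h₃
        subst h₁ h₂ h₃
        simp [ih]
      · rw [sentOn_cons_send, List.count_cons_of_ne h, ← ih]
        split_ifs with hpq
        · obtain ⟨rfl, rfl⟩ := hpq
          exact List.count_cons_of_ne fun hm => h (by rw [hm])
        · rfl
    | recv p' q' m' => simp [ih]

theorem count_receivedOn (p q : P) (m : M) (e : List (Act P M)) :
    (receivedOn p q e).count m = e.count (Act.recv p q m) := by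
  induction e with
  | nil => rfl
  | cons a e ih =>
    cases a with
    | recv p' q' m' =>
      by_cases h : Act.recv p' q' m' = Act.recv p q m
      · injection h with h₁ h₂ h₃
        subst h₁ h₂ h₃
        simp [ih]
      · rw [receivedOn_cons_recv, List.count_cons_of_ne h, ← ih]
        split_ifs with hpq
        · obtain ⟨rfl, rfl⟩ := hpq
          exact List.count_cons_of_ne fun hm => h (by rw [hm])
        · rfl
    | send p' q' m' => simp [ih]

theorem IsFIFO.prefixBalanced {e : List (Act P M)} (h : IsFIFO e) : PrefixBalanced e := by
  intro x hx p q m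
  rw [← count_sentOn, ← count_receivedOn]
  exact (h x hx p q).sublist.count_le m

omit [DecidableEq M] in
theorem IsFIFO.of_prefix {x e : List (Act P M)} (h : IsFIFO e) (hx : x <+: e) : IsFIFO x :=
  fun _ hy => h _ (hy.trans hx)

omit [DecidableEq M] in
theorem IsFIFO.concat {e : List (Act P M)} {a : Act P M} (h : IsFIFO e)
    (ha : ∀ p q, receivedOn p q (e ++ [a]) <+: sentOn p q (e ++ [a])) : IsFIFO (e ++ [a]) := by
  intro x hx
  rcases List.prefix_concat_iff.1 hx with rfl | hx
  · exact ha
  · exact h x hx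

omit [DecidableEq M] in
theorem exists_receivedOn_take_eq {e : List (Act P M)} {p q : P} {y : List M} {m : M}
    (h : y ++ [m] <+: receivedOn p q e) :
    ∃ i, e[i]? = some (Act.recv p q m) ∧ receivedOn p q (e.take (i + 1)) = y ++ [m] := by
  induction e using List.reverseRecOn with
  | nil => simp at h
  | append_singleton e a ih =>
    have step : y ++ [m] <+: receivedOn p q e → ∃ i, (e ++ [a])[i]? = some (Act.recv p q m) ∧
        receivedOn p q ((e ++ [a]).take (i + 1)) = y ++ [m] := by
      intro h'
      obtain ⟨i, hi, hr⟩ := ih h'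
      have hl := (List.getElem?_eq_some_iff.1 hi).1
      exact ⟨i, by rw [List.getElem?_append_left hl, hi],
        by rw [List.take_append_of_le_length (by omega), hr]⟩
    cases a with
    | send p' q' m' => exact step (by simpa using h)
    | recv p' q' m' =>
      by_cases hpq : p' = p ∧ q' = q
      · obtain ⟨rfl, rfl⟩ := hpq
        simp only [receivedOn_append, receivedOn_cons_recv, and_self, if_true,
          receivedOn_nil] at h
        rcases List.prefix_concat_iff.1 h with h' | h'
        · obtain ⟨rfl, h'⟩ := List.append_inj' h' rfl
          obtain rfl : m = m' := by simpa using h'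
          refine ⟨e.length, by simp, ?_⟩
          rw [List.take_of_length_le (by simp)]
          simp
        · exact step h'
      · exact step (by simpa [hpq] using h)

/-- The messages sent before a matched send are exactly those received before its receive. -/
theorem IsFIFO.receivedOn_take_eq {e : List (Act P M)} (h : IsFIFO e) {i j : ℕ} {p q : P} {m : M}
    (hm : Matches e i j) (hi : e[i]? = some (Act.send p q m)) :
    e[j]? = some (Act.recv p q m) ∧
      receivedOn p q (e.take (j + 1)) = sentOn p q (e.take (i + 1)) := by
  obtain ⟨hij, hj, p', q', m', hs, hr, hc⟩ := hm
  rw [hi, Option.some.injEq] at hs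
  injection hs with e₁ e₂ e₃
  subst e₁ e₂ e₃
  refine ⟨hr, ?_⟩
  have h₁ := h _ (List.take_prefix (j + 1) e) p q
  have h₂ : sentOn p q (e.take (i + 1)) <+: sentOn p q (e.take (j + 1)) :=
    (List.take_prefix_take_left (by omega)).filterMap _
  rw [← count_sentOn, ← count_receivedOn] at hc
  rw [List.take_succ_eq_of_getElem? hi] at h₂ hc ⊢
  rw [List.take_succ_eq_of_getElem? hr] at h₁ hc ⊢
  simp only [sentOn_append, receivedOn_append, sentOn_cons_send, receivedOn_cons_recv, and_self,
    if_true, sentOn_nil, receivedOn_nil] at h₁ h₂ hc ⊢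
  rw [List.concat_eq_concat_of_prefix_of_count_eq h₁
    (by rw [List.take_succ_eq_of_getElem? hr] at h₂; simpa using h₂) hc.symm]

theorem mscOf_lt_of_prec {e : List (Act P M)} {i j : Fin (mscOf e).n}
    (h : (mscOf e).prec i j) : (i : ℕ) < j := by
  have step : ∀ {i j : Fin (mscOf e).n}, (mscOf e).po i j ∨ (mscOf e).src i j → (i : ℕ) < j := by
    rintro i j (h | h)
    · exact h.1
    · exact h.1
  induction h with
  | single h => exact step h
  | tail _ h ih => exact ih.trans (step h)

theorem IsFIFO.p2pCausalDelivery {e : List (Act P M)} (h : IsFIFO e) :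
    P2PCausalDelivery (mscOf e) := by
  have hwf := h.prefixBalanced.wfSeq
  refine ⟨e, ⟨hwf, mscIso_of_procProj_eq hwf hwf fun _ => rfl⟩, ?_⟩
  intro i j p q v v' hij hi hj
  replace hi : e[(i : ℕ)]? = some (Act.send p q v) :=
    (getElem?_get e i).trans (congrArg some hi)
  replace hj : e[(j : ℕ)]? = some (Act.send p q v') :=
    (getElem?_get e j).trans (congrArg some hj)
  have hlt := mscOf_lt_of_prec hij
  by_contra! hcon
  obtain ⟨⟨j', hm⟩, hcon⟩ := hcon
  obtain ⟨hj', hr⟩ := h.receivedOn_take_eq hm hj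
  have hjlen := (List.getElem?_eq_some_iff.1 hj').1
  have hsent : sentOn p q (e.take (i + 1)) = sentOn p q (e.take i) ++ [v] := by
    rw [List.take_succ_eq_of_getElem? hi]
    simp
  have hsent' : sentOn p q (e.take (j + 1)) = sentOn p q (e.take j) ++ [v'] := by
    rw [List.take_succ_eq_of_getElem? hj]
    simp
  have hle : sentOn p q (e.take (i + 1)) <+: sentOn p q (e.take j) :=
    (List.take_prefix_take_left (by omega)).filterMap _
  obtain ⟨i', hi', hr'⟩ := exists_receivedOn_take_eq (e := e.take j') (p := p) (q := q)
    (y := sentOn p q (e.take i)) (m := v) (by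
      rw [List.take_succ_eq_of_getElem? hj', hsent'] at hr
      simp only [receivedOn_append, receivedOn_cons_recv, and_self, if_true,
        receivedOn_nil] at hr
      rw [(List.append_inj' hr rfl).1, ← hsent]
      exact hle)
  have hilt' := (List.getElem?_eq_some_iff.1 hi').1
  rw [List.length_take] at hilt'
  rw [List.getElem?_take_of_lt (by omega)] at hi'
  rw [List.take_take, min_eq_left (by omega)] at hr'
  have hmi : Matches e i i' := by
    refine ⟨?_, by omega, p, q, v, hi, hi', ?_⟩
    · by_contra hge
      have hf := (h _ (List.take_prefix (i' + 1) e) p q).length_le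
      have hs : (sentOn p q (e.take (i' + 1))).length ≤ (sentOn p q (e.take i)).length := by
        refine List.IsPrefix.length_le ((List.take_prefix_take_left ?_).filterMap _)
        rcases Nat.lt_or_ge i' i with h' | h'
        · exact h'
        · obtain rfl : i' = i := by omega
          rw [hi] at hi'
          cases hi'
      rw [hr'] at hf
      simp at hf
      omega
    · rw [← count_sentOn, ← count_receivedOn, hr', hsent]
  refine hcon ⟨i', by change i' < e.length; omega⟩ ⟨j', hjlen⟩ hmi hm
    (Relation.TransGen.single (Or.inl ⟨by change i' < j'; omega, ?_⟩))
  have e₁ := (getElem?_get e ⟨i', by omega⟩).symm.trans hi'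
  have e₂ := (getElem?_get e ⟨j', hjlen⟩).symm.trans hj'
  exact (congrArg Act.proc (Option.some.inj e₁)).trans
    (congrArg Act.proc (Option.some.inj e₂)).symm

omit [DecidableEq M] in
theorem LocalRun.append {S : CSystem P M St} {l l' l'' : P → St} {x y : List (Act P M)}
    (hx : LocalRun S l x l') (hy : LocalRun S l' y l'') : LocalRun S l (x ++ y) l'' := by
  induction hx with
  | nil => exact hy
  | cons h _ ih => exact .cons h (ih hy)

omit [DecidableEq M] in
theorem LocalRun.exists_of_append {S : CSystem P M St} {l l'' : P → St} {x y : List (Act P M)}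
    (h : LocalRun S l (x ++ y) l'') : ∃ l', LocalRun S l x l' ∧ LocalRun S l' y l'' := by
  induction x generalizing l with
  | nil => exact ⟨l, .nil, h⟩
  | cons a x ih =>
    cases h with
    | cons ha h =>
      obtain ⟨l', h₁, h₂⟩ := ih h
      exact ⟨l', .cons ha h₁, h₂⟩

omit [DecidableEq M] in
theorem P2PExecFrom.localRun {S : CSystem P M St} {c c' : (P → St) × (P → P → List M)}
    {e : List (Act P M)} (h : P2PExecFrom S c e c') : LocalRun S c.1 e c'.1 := by
  induction h with
  | nil => exact .nil
  | cons hs _ ih =>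
    cases hs with
    | send hd => exact .cons hd ih
    | recv hd _ => exact .cons hd ih

omit [DecidableEq M] in
theorem P2PExecFrom.receivedOn_append {S : CSystem P M St}
    {c c' : (P → St) × (P → P → List M)} {e : List (Act P M)} (h : P2PExecFrom S c e c')
    (p q : P) : receivedOn p q e ++ c'.2 p q = c.2 p q ++ sentOn p q e := by
  induction h with
  | nil => simp
  | cons hs _ ih =>
    cases hs with
    | @send l b p' q' m l' hd =>
      simp only [receivedOn_cons_send, sentOn_cons_send] at ih ⊢
      rw [ih]
      by_cases hpq : p' = p ∧ q' = q
      · obtain ⟨rfl, rfl⟩ := hpq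
        simp
      · have hpq' : ¬ (p = p' ∧ q = q') := fun h => hpq ⟨h.1.symm, h.2.symm⟩
        simp [hpq, hpq']
    | @recv l b p' q' m l' rest hd hb =>
      simp only [receivedOn_cons_recv, sentOn_cons_recv] at ih ⊢
      by_cases hpq : p' = p ∧ q' = q
      · obtain ⟨rfl, rfl⟩ := hpq
        simp only [and_self, if_true] at ih ⊢
        rw [List.cons_append, ih, hb, List.cons_append]
      · have hpq' : ¬ (p = p' ∧ q = q') := fun h => hpq ⟨h.1.symm, h.2.symm⟩
        simp only [hpq, hpq', if_false] at ih ⊢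
        exact ih

omit [DecidableEq M] in
theorem P2PExecFrom.exists_of_append {S : CSystem P M St} {c c'' : (P → St) × (P → P → List M)}
    {x y : List (Act P M)} (h : P2PExecFrom S c (x ++ y) c'') : ∃ c', P2PExecFrom S c x c' := by
  induction x generalizing c with
  | nil => exact ⟨c, .nil⟩
  | cons a x ih =>
    cases h with
    | cons ha h =>
      obtain ⟨c', h₁⟩ := ih h
      exact ⟨c', .cons ha h₁⟩

omit [DecidableEq M] in
theorem LocalRun.exists_p2pExecFrom {S : CSystem P M St} {l l' : P → St} {e : List (Act P M)}
    (h : LocalRun S l e l') (b : P → P → List M)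
    (hb : ∀ x, x <+: e → ∀ p q, receivedOn p q x <+: b p q ++ sentOn p q x) :
    ∃ c, P2PExecFrom S (l, b) e c := by
  induction h generalizing b with
  | nil => exact ⟨_, .nil⟩
  | @cons l l'' a s e hd _ ih =>
    cases a with
    | send p q m =>
      obtain ⟨c, hc⟩ := ih (fun p' q' => if p' = p ∧ q' = q then b p q ++ [m] else b p' q') (by
        intro x hx p' q'
        have := hb (Act.send p q m :: x) (List.prefix_cons_inj _ |>.2 hx) p' q'
        simp only [receivedOn_cons_send, sentOn_cons_send] at this
        by_cases hpq : p = p' ∧ q = q'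
        · obtain ⟨rfl, rfl⟩ := hpq
          simpa using this
        · have hpq' : ¬ (p' = p ∧ q' = q) := fun h => hpq ⟨h.1.symm, h.2.symm⟩
          simpa [hpq, hpq'] using this)
      exact ⟨c, .cons (.send hd) hc⟩
    | recv p q m =>
      have h₁ := hb [Act.recv p q m] (by simp) p q
      simp only [receivedOn_cons_recv, and_self, if_true, receivedOn_nil, sentOn_cons_recv,
        sentOn_nil, List.append_nil] at h₁
      obtain ⟨rest, hrest⟩ := h₁
      obtain ⟨c, hc⟩ := ih (fun p' q' => if p' = p ∧ q' = q then rest else b p' q') (by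
        intro x hx p' q'
        have := hb (Act.recv p q m :: x) (List.prefix_cons_inj _ |>.2 hx) p' q'
        simp only [receivedOn_cons_recv, sentOn_cons_recv] at this
        by_cases hpq : p = p' ∧ q = q'
        · obtain ⟨rfl, rfl⟩ := hpq
          rw [← hrest] at this
          simpa using this
        · have hpq' : ¬ (p' = p ∧ q' = q) := fun h => hpq ⟨h.1.symm, h.2.symm⟩
          simpa [hpq, hpq'] using this)
      exact ⟨c, .cons (.recv hd hrest.symm) hc⟩

omit [DecidableEq M] in
theorem p2pAsEx_iff {S : CSystem P M St} {e : List (Act P M)} :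
    p2pAsEx S e ↔ (∃ l, LocalRun S S.init e l) ∧ IsFIFO e := by
  constructor
  · rintro ⟨c, hc⟩
    refine ⟨⟨_, hc.localRun⟩, ?_⟩
    rintro x ⟨y, rfl⟩ p q
    obtain ⟨c', hc'⟩ := hc.exists_of_append
    exact ⟨_, hc'.receivedOn_append p q⟩
  · rintro ⟨⟨l, hl⟩, hf⟩
    exact hl.exists_p2pExecFrom _ fun x hx p q => by simpa using hf x hx p q

omit [DecidableEq M] in
theorem p2pAsEx.isFIFO {S : CSystem P M St} {e : List (Act P M)} (h : p2pAsEx S e) : IsFIFO e :=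
  (p2pAsEx_iff.1 h).2

omit [DecidableEq M] in
theorem p2pAsEx.of_append {S : CSystem P M St} {x y : List (Act P M)} (h : p2pAsEx S (x ++ y)) :
    p2pAsEx S x := by
  obtain ⟨c, hc⟩ := h
  exact hc.exists_of_append

theorem p2pAsEx.p2pKSyncSeq_iff {k : ℕ} {S : CSystem P M St} {e : List (Act P M)}
    (h : p2pAsEx S e) : P2PKSyncSeq k e ↔ ∃ es : List (List (Act P M)),
      (∀ b ∈ es, IsBlock k b) ∧ BlockBalanced es ∧
        ∀ p, procProj p es.flatten = procProj p e :=
  _root_.p2pKSyncSeq_iff h.isFIFO.prefixBalanced.wfSeq h.isFIFO.p2pCausalDelivery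

end Channels

/-! ## Appending a send -/

section Blocks
variable {P M St : Type} [DecidableEq P] [DecidableEq M]

omit [DecidableEq P] [DecidableEq M] in
theorem isBlock_pair {k : ℕ} (hk : 1 ≤ k) (p q p' q' : P) (m m' : M) :
    IsBlock k [Act.send p q m, Act.recv p' q' m'] :=
  ⟨[Act.send p q m], [Act.recv p' q' m'], rfl, by simp [Act.isSend], by simp [Act.isRecv],
    hk, hk⟩

omit [DecidableEq P] [DecidableEq M] in
theorem isBlock_send {k : ℕ} (hk : 1 ≤ k) (p q : P) (m : M) : IsBlock k [Act.send p q m] :=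
  ⟨[Act.send p q m], [], rfl, by simp [Act.isSend], by simp, hk, Nat.zero_le _⟩

omit [DecidableEq P] [DecidableEq M] in
theorem IsBlock.exists_of_send {k : ℕ} {x y : List (Act P M)} {p q : P} {m : M}
    (h : IsBlock k (x ++ Act.send p q m :: y)) :
    ∃ ss rs, y = ss ++ rs ∧ (∀ a ∈ x, a.isSend) ∧ (∀ a ∈ ss, a.isSend) ∧
      (∀ a ∈ rs, a.isRecv) ∧ x.length + 1 + ss.length ≤ k := by
  obtain ⟨ss, rs, hsr, hss, hrs, hlen, -⟩ := h
  rcases List.append_eq_append_iff.1 hsr with ⟨t, rfl, ht⟩ | ⟨t, rfl, rfl⟩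
  · cases t with
    | nil =>
      obtain rfl : Act.send p q m :: y = rs := by simpa using ht
      exact (hrs _ List.mem_cons_self).elim
    | cons a t =>
      obtain ⟨rfl, rfl⟩ := List.cons.inj ht
      refine ⟨t, rs, rfl, fun a ha => hss a (by simp [ha]), fun a ha => hss a (by simp [ha]),
        hrs, ?_⟩
      simp at hlen
      omega
  · have : (Act.send p q m).isRecv := hrs _ (by simp)
    exact this.elim

theorem BlockBalanced.concat_send {es : List (List (Act P M))} (h : BlockBalanced es)
    (p q : P) (m : M) : BlockBalanced (es ++ [[Act.send p q m]]) := by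
  intro A B hAB p' q' m'
  rcases List.append_eq_append_iff.1 hAB with ⟨t, rfl, ht⟩ | ⟨t, rfl, rfl⟩
  · have h₁ := (h es [] (by simp) p' q' m').1
    have h₂ : B.flatten.count (Act.recv p' q' m') = 0 := by
      have := congrArg (fun l => l.flatten.count (Act.recv p' q' m')) ht
      simp [List.count_append] at this
      omega
    refine ⟨?_, Or.inr h₂⟩
    have h₃ : t.flatten.count (Act.recv p' q' m') = 0 := by
      have := congrArg (fun l => l.flatten.count (Act.recv p' q' m')) ht
      simp [List.count_append] at this
      omega
    rw [List.flatten_append, List.count_append, List.count_append]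
    omega
  · have := h A t rfl p' q' m'
    simpa [List.count_append] using this

theorem p2pKSyncSeq_concat_send {k : ℕ} (hk : 1 ≤ k) {S : CSystem P M St} {e : List (Act P M)}
    {p q : P} {m : M} (he : p2pAsEx S (e ++ [Act.send p q m])) (h : P2PKSyncSeq k e) :
    P2PKSyncSeq k (e ++ [Act.send p q m]) := by
  obtain ⟨es, hb, hbal, hp⟩ := he.of_append.p2pKSyncSeq_iff.1 h
  refine he.p2pKSyncSeq_iff.2 ⟨es ++ [[Act.send p q m]], ?_, hbal.concat_send p q m, fun r => ?_⟩
  · intro b hb'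
    rcases List.mem_append.1 hb' with hb' | hb'
    · exact hb b hb'
    · rw [List.mem_singleton.1 hb']
      exact isBlock_send hk p q m
  · simp only [List.flatten_append, procProj_append, hp, List.flatten_cons, List.flatten_nil,
      List.append_nil]

/-- The send corresponding to an action. -/
def Act.toSend : Act P M → Act P M
  | Act.send p q m => Act.send p q m
  | Act.recv p q m => Act.send p q m

theorem length_le_of_count_recv_le {rs l : List (Act P M)} (hrs : ∀ a ∈ rs, a.isRecv)
    (h : ∀ p q m, rs.count (Act.recv p q m) ≤ l.count (Act.send p q m)) :
    rs.length ≤ l.length := by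
  have hcount : ∀ p q m, (rs.map Act.toSend).count (Act.send p q m) =
      rs.count (Act.recv p q m) := by
    intro p q m
    clear h
    induction rs with
    | nil => rfl
    | cons a rs ih =>
      have ih := ih fun a ha => hrs a (List.mem_cons_of_mem _ ha)
      cases a with
      | send p' q' m' => exact (hrs _ List.mem_cons_self).elim
      | recv p' q' m' => simp [List.count_cons, ih, Act.toSend]
  have hsub : (rs.map Act.toSend).Subperm l := by
    refine List.subperm_ext_iff.2 fun a ha => ?_
    cases a with
    | send p q m => rw [hcount]; exact h p q m
    | recv p q m =>
      obtain ⟨b, -, hb⟩ := List.mem_map.1 ha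
      cases b <;> cases hb
  simpa using hsub.length_le

end Blocks

/-! ## Deviations -/

section Deviations
variable {P M St : Type}

theorem liftAct_injective : Function.Injective (liftAct : Act P M → IAct P M) := by
  rintro (⟨p, q, m⟩ | ⟨p, q, m⟩) (⟨p', q', m'⟩ | ⟨p', q', m'⟩) h <;> simp_all [liftAct]

/-- The global state of the instrumented system made of a state of `S` and a state of `π`. -/
def liftState (l : P → St) (s : ISt P M St) : IProc P → ISt P M St
  | some p => Sum.inl (l p)
  | none => s

variable [DecidableEq P]

theorem update_liftState_some (l : P → St) (s : ISt P M St) (p : P) (t : St) :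
    Function.update (liftState l s) (some p) (Sum.inl t) =
      liftState (Function.update l p t) s := by
  funext x
  cases x with
  | none => simp [liftState]
  | some x =>
    by_cases hx : x = p
    · subst hx; simp [liftState]
    · simp [liftState, hx]

theorem update_liftState_none (l : P → St) (s t : ISt P M St) :
    Function.update (liftState l s) none t = liftState l t := by
  funext x
  cases x <;> simp [liftState]

theorem LocalRun.map_liftAct {S : CSystem P M St} {l l' : P → St} {e : List (Act P M)}
    (h : LocalRun S l e l') (s : ISt P M St) :
    LocalRun (instrumented S) (liftState l s) (e.map liftAct) (liftState l' s) := by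
  induction h with
  | nil => exact .nil
  | @cons l l'' a t e hd _ ih =>
    refine .cons (s := Sum.inl t) ?_ (l := liftState l s) ?_
    · cases a with
      | send p q m => exact .origSend hd
      | recv p q m => exact .origRecv hd
    · cases a with
      | send p q m =>
        rw [show (liftAct (Act.send p q m)).proc = some p from rfl, update_liftState_some]
        exact ih
      | recv p q m =>
        rw [show (liftAct (Act.recv p q m)).proc = some q from rfl, update_liftState_some]
        exact ih

theorem procProj_some_map_liftAct (p : P) (e : List (Act P M)) :
    procProj (some p) (e.map liftAct) = (procProj p e).map liftAct := by
  rw [procProj, procProj, List.filter_map]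
  congr 1
  refine List.filter_congr fun a _ => ?_
  cases a <;> simp only [liftAct, Act.proc, Function.comp, Option.some.injEq] <;>
    exact decide_eq_decide.2 Iff.rfl

theorem procProj_none_map_liftAct (e : List (Act P M)) :
    procProj none (e.map liftAct) = [] := by
  rw [procProj, List.filter_eq_nil_iff]
  intro a ha
  obtain ⟨b, -, rfl⟩ := List.mem_map.1 ha
  cases b <;> simp [liftAct, Act.proc]

theorem sentOn_some_map_liftAct (p q : P) (e : List (Act P M)) :
    sentOn (some p) (some q) (e.map liftAct) = (sentOn p q e).map Sum.inl := by
  induction e with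
  | nil => rfl
  | cons a e ih => cases a <;> simp [liftAct, ih, apply_ite (List.map _)]

theorem receivedOn_some_map_liftAct (p q : P) (e : List (Act P M)) :
    receivedOn (some p) (some q) (e.map liftAct) = (receivedOn p q e).map Sum.inl := by
  induction e with
  | nil => rfl
  | cons a e ih => cases a <;> simp [liftAct, ih, apply_ite (List.map _)]

theorem receivedOn_none_left_map_liftAct (q : IProc P) (e : List (Act P M)) :
    receivedOn none q (e.map liftAct) = [] := by
  induction e with
  | nil => rfl
  | cons a e ih => cases a <;> simp [liftAct, ih]

theorem receivedOn_none_right_map_liftAct (p : IProc P) (e : List (Act P M)) :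
    receivedOn p none (e.map liftAct) = [] := by
  induction e with
  | nil => rfl
  | cons a e ih => cases a <;> simp [liftAct, ih]

theorem sentOn_none_right_map_liftAct (p : IProc P) (e : List (Act P M)) :
    sentOn p none (e.map liftAct) = [] := by
  induction e with
  | nil => rfl
  | cons a e ih => cases a <;> simp [liftAct, ih]

theorem sentOn_none_left_map_liftAct (q : IProc P) (e : List (Act P M)) :
    sentOn none q (e.map liftAct) = [] := by
  induction e with
  | nil => rfl
  | cons a e ih => cases a <;> simp [liftAct, ih]

/-- The deviation of `e₁ · send(p,q,m) · e₂ · rec(p,q,m)` through `π`. -/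
def deviation (e₁ e₂ : List (Act P M)) (p q : P) (m : M) : List (IAct P M) :=
  e₁.map liftAct ++
    [Act.send (some p) none (Sum.inr (q, m)), Act.recv (some p) none (Sum.inr (q, m))] ++
    e₂.map liftAct ++
    [Act.send none (some q) (Sum.inl m), Act.recv none (some q) (Sum.inl m)]

theorem isFIFO_map_liftAct {e : List (Act P M)} (h : IsFIFO e) : IsFIFO (e.map liftAct) := by
  intro x hx P₀ Q₀
  obtain ⟨y, hy, rfl⟩ := List.prefix_map_iff.1 hx
  cases P₀ with
  | none => rw [receivedOn_none_left_map_liftAct]; exact List.nil_prefix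
  | some a =>
    cases Q₀ with
    | none => rw [receivedOn_none_right_map_liftAct]; exact List.nil_prefix
    | some b =>
      rw [receivedOn_some_map_liftAct, sentOn_some_map_liftAct]
      exact (h y hy a b).map _

theorem isFIFO_deviation {e₁ e₂ : List (Act P M)} {p q : P} {m : M}
    (h : IsFIFO (e₁ ++ Act.send p q m :: e₂))
    (hpq : receivedOn p q (e₁ ++ e₂) = sentOn p q e₁) : IsFIFO (deviation e₁ e₂ p q m) := by
  have h₁ : IsFIFO (e₁.map liftAct ++ [(Act.send (some p) none (Sum.inr (q, m)) : IAct P M)]) := by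
    have h₀ := isFIFO_map_liftAct (h.of_prefix (List.prefix_append e₁ _))
    refine h₀.concat fun P₀ Q₀ => ?_
    simp only [receivedOn_append, receivedOn_cons_send, receivedOn_nil, List.append_nil,
      sentOn_append]
    exact (h₀ _ (List.prefix_refl _) P₀ Q₀).trans (List.prefix_append _ _)
  have h₂ := h₁.concat (a := Act.recv (some p) none (Sum.inr (q, m))) fun P₀ Q₀ => by
    have := h₁ _ (List.prefix_refl _) P₀ Q₀
    by_cases hc : some p = P₀ ∧ none = Q₀
    · obtain ⟨rfl, rfl⟩ := hc
      simp [receivedOn_none_right_map_liftAct, sentOn_none_right_map_liftAct]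
    · simpa [hc] using this
  have h₃ : ∀ z, z <+: e₂ → IsFIFO (e₁.map liftAct ++
      [Act.send (some p) none (Sum.inr (q, m)), Act.recv (some p) none (Sum.inr (q, m))] ++
      z.map liftAct) := by
    intro z hz
    induction z using List.reverseRecOn with
    | nil => simpa using h₂
    | append_singleton z a ih =>
      have ih := ih ((List.prefix_append z [a]).trans hz)
      rw [List.map_append, List.map_singleton, ← List.append_assoc]
      refine ih.concat fun P₀ Q₀ => ?_
      rw [List.append_assoc _ (z.map liftAct), show z.map liftAct ++ [liftAct a] =
        (z ++ [a]).map liftAct by simp]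
      generalize z ++ [a] = z at hz
      cases P₀ with
      | none => simp [receivedOn_none_left_map_liftAct]
      | some a =>
        cases Q₀ with
        | none =>
          simp [receivedOn_none_right_map_liftAct, sentOn_none_right_map_liftAct]
        | some b =>
          simp only [receivedOn_append, sentOn_append, receivedOn_some_map_liftAct,
            sentOn_some_map_liftAct, receivedOn_cons_send, receivedOn_cons_recv,
            sentOn_cons_send, sentOn_cons_recv, reduceCtorEq, and_false, if_false,
            receivedOn_nil, sentOn_nil, List.append_nil, ← List.map_append]
          refine List.IsPrefix.map _ ?_
          by_cases hc : p = a ∧ q = b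
          · obtain ⟨rfl, rfl⟩ := hc
            refine List.IsPrefix.trans ?_ (List.prefix_append _ _)
            rw [← hpq, receivedOn_append]
            exact List.prefix_append_right_inj _ |>.2 (hz.filterMap _)
          · have hz' : e₁ ++ Act.send p q m :: z <+: e₁ ++ Act.send p q m :: e₂ :=
              List.prefix_append_right_inj _ |>.2 (List.prefix_cons_inj _ |>.2 hz)
            simpa [hc] using h _ hz' a b
  have h₄ := (h₃ e₂ (List.prefix_refl _)).concat (a := Act.send none (some q) (Sum.inl m))
    fun P₀ Q₀ => by
      have := h₃ e₂ (List.prefix_refl _) _ (List.prefix_refl _) P₀ Q₀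
      rw [receivedOn_append, receivedOn_cons_send, receivedOn_nil, List.append_nil, sentOn_append]
      exact this.trans (List.prefix_append _ _)
  have h₅ := h₄.concat (a := Act.recv none (some q) (Sum.inl m)) fun P₀ Q₀ => by
    have := h₄ _ (List.prefix_refl _) P₀ Q₀
    by_cases hc : none = P₀ ∧ some q = Q₀
    · obtain ⟨rfl, rfl⟩ := hc
      simp [receivedOn_none_left_map_liftAct, sentOn_none_left_map_liftAct]
    · rw [receivedOn_append, receivedOn_cons_recv, if_neg hc, sentOn_append, sentOn_cons_recv]
      simpa using this
  simpa [deviation] using h₅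

theorem p2pAsEx_deviation {S : CSystem P M St} {e₁ e₂ : List (Act P M)} {p q : P} {m : M}
    (h : p2pAsEx S (e₁ ++ Act.send p q m :: e₂ ++ [Act.recv p q m]))
    (hpq : receivedOn p q (e₁ ++ e₂) = sentOn p q e₁) :
    p2pAsEx (instrumented S) (deviation e₁ e₂ p q m) := by
  refine p2pAsEx_iff.2 ⟨?_, isFIFO_deviation h.of_append.isFIFO hpq⟩
  obtain ⟨⟨l, hl⟩, -⟩ := p2pAsEx_iff.1 h
  rw [List.append_assoc] at hl
  obtain ⟨l₁, hl₁, hl⟩ := hl.exists_of_append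
  cases hl with
  | @cons _ _ _ s₁ _ hs hl =>
    obtain ⟨l₂, hl₂, hl⟩ := hl.exists_of_append
    cases hl with
    | @cons _ _ _ s₂ _ hr hl =>
      have hinit : (instrumented S).init = liftState S.init (Sum.inr (Sum.inr false)) := by
        funext x
        cases x <;> rfl
      rw [hinit]
      refine ⟨liftState (Function.update l₂ q s₂) (Sum.inr (Sum.inr true)), ((hl₁.map_liftAct _).append ?_ |>.append (hl₂.map_liftAct
        (Sum.inr (Sum.inl (q, m))))).append ?_⟩
      · refine .cons (s := Sum.inl s₁) (.devSend hs) ?_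
        rw [show (Act.send (some p) none (Sum.inr (q, m)) : IAct P M).proc = some p from rfl,
          update_liftState_some]
        refine .cons (s := Sum.inr (Sum.inl (q, m))) .piRecv ?_
        rw [show (Act.recv (some p) none (Sum.inr (q, m)) : IAct P M).proc = none from rfl,
          update_liftState_none]
        exact .nil
      · refine .cons (s := Sum.inr (Sum.inr true)) .piSend ?_
        rw [show (Act.send none (some q) (Sum.inl m) : IAct P M).proc = none from rfl,
          update_liftState_none]
        refine .cons (s := Sum.inl s₂) (.devRecv hr) ?_
        rw [show (Act.recv none (some q) (Sum.inl m) : IAct P M).proc = some q from rfl,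
          update_liftState_some]
        exact .nil

end Deviations

/-! ## Synchronizability of deviations -/

section DeviationBlocks
variable {P M St : Type} [DecidableEq P] [DecidableEq M]

theorem count_send_map_liftAct (p q : P) (m : M) (x : List (Act P M)) :
    (x.map liftAct).count (Act.send (some p) (some q) (Sum.inl m)) = x.count (Act.send p q m) :=
  List.count_map_of_injective x liftAct liftAct_injective (Act.send p q m)

theorem count_recv_map_liftAct (p q : P) (m : M) (x : List (Act P M)) :
    (x.map liftAct).count (Act.recv (some p) (some q) (Sum.inl m)) = x.count (Act.recv p q m) :=
  List.count_map_of_injective x liftAct liftAct_injective (Act.recv p q m)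

theorem eq_some_or_count_map_liftAct_eq_zero (p q : IProc P) (m : IMsg P M) :
    (∃ a b v, p = some a ∧ q = some b ∧ m = Sum.inl v) ∨
      ∀ x : List (Act P M), (x.map liftAct).count (Act.send p q m) = 0 ∧
        (x.map liftAct).count (Act.recv p q m) = 0 := by
  by_cases h : ∃ a b v, p = some a ∧ q = some b ∧ m = Sum.inl v
  · exact Or.inl h
  · refine Or.inr fun x => ⟨List.count_eq_zero.2 fun hx => h ?_,
      List.count_eq_zero.2 fun hx => h ?_⟩ <;>
    · obtain ⟨a, -, ha⟩ := List.mem_map.1 hx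
      cases a <;> cases ha
      exact ⟨_, _, _, rfl, rfl, rfl⟩

/-- The blocks of a deviation: the deviated message is received by `π` at the end of the block
in which it is sent, and forwarded in a new block. -/
def deviationBlocks (A B : List (List (Act P M))) (b₁ b₂ : List (Act P M)) (p q : P) (m : M) :
    List (List (IAct P M)) :=
  A.map (List.map liftAct) ++
    (b₁.map liftAct ++ Act.send (some p) none (Sum.inr (q, m)) ::
      (b₂.map liftAct ++ [Act.recv (some p) none (Sum.inr (q, m))])) ::
    (B.map (List.map liftAct) ++
      [[Act.send none (some q) (Sum.inl m), Act.recv none (some q) (Sum.inl m)]])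

theorem BlockBalanced.deviate {A B : List (List (Act P M))} {b₁ b₂ : List (Act P M)}
    {p q : P} {m : M} (h : BlockBalanced (A ++ (b₁ ++ Act.send p q m :: b₂) :: B))
    (hc : (A ++ (b₁ ++ Act.send p q m :: b₂) :: B).flatten.count (Act.recv p q m) =
      (A.flatten ++ b₁).count (Act.send p q m)) :
    BlockBalanced (deviationBlocks A B b₁ b₂ p q m) := by
  intro C D hCD P₀ Q₀ m₀
  have hcases : (∃ A₁ A₂, A = A₁ ++ A₂ ∧ C = A₁.map (List.map liftAct) ∧
        D = deviationBlocks A₂ B b₁ b₂ p q m) ∨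
      (∃ B₁ B₂, B = B₁ ++ B₂ ∧
        C = A.map (List.map liftAct) ++
          (b₁.map liftAct ++ Act.send (some p) none (Sum.inr (q, m)) ::
            (b₂.map liftAct ++ [Act.recv (some p) none (Sum.inr (q, m))])) ::
          B₁.map (List.map liftAct) ∧
        D = B₂.map (List.map liftAct) ++
          [[Act.send none (some q) (Sum.inl m), Act.recv none (some q) (Sum.inl m)]]) ∨
      (C = deviationBlocks A B b₁ b₂ p q m ∧ D = []) := by
    rcases List.append_eq_append_iff.1 hCD.symm with ⟨t, hA, rfl⟩ | ⟨t, rfl, ht⟩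
    · obtain ⟨A₁, A₂, rfl, rfl, rfl⟩ := List.map_eq_append_iff.1 hA
      exact Or.inl ⟨A₁, A₂, rfl, rfl, rfl⟩
    · cases t with
      | nil =>
        exact Or.inl ⟨A, [], by simp, by simp, by simpa [deviationBlocks] using ht.symm⟩
      | cons c t =>
        rw [List.cons_append] at ht
        obtain ⟨rfl, ht'⟩ := List.cons.inj ht
        rcases List.append_eq_append_iff.1 ht' with ⟨u, rfl, hu⟩ | ⟨u, hB, rfl⟩
        · cases u with
          | nil => exact Or.inr (Or.inl ⟨B, [], by simp, by simp, by simpa using hu.symm⟩)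
          | cons d u =>
            obtain ⟨rfl, hu'⟩ := List.cons.inj hu
            obtain ⟨rfl, rfl⟩ := List.append_eq_nil_iff.1 hu'.symm
            exact Or.inr (Or.inr ⟨by simp [deviationBlocks], rfl⟩)
        · obtain ⟨B₁, B₂, rfl, rfl, rfl⟩ := List.map_eq_append_iff.1 hB
          exact Or.inr (Or.inl ⟨B₁, B₂, rfl, rfl, rfl⟩)
  have hflat : ∀ X : List (List (Act P M)), (X.map (List.map liftAct)).flatten =
      X.flatten.map (liftAct : Act P M → IAct P M) := fun X => List.map_flatten.symm
  simp only [List.flatten_append, List.flatten_cons, List.count_append, List.count_cons] at hc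
  rcases eq_some_or_count_map_liftAct_eq_zero P₀ Q₀ m₀ with ⟨a, b, v, rfl, rfl, rfl⟩ | hzero
  · have hpqm : ((Act.send p q m == Act.send a b v) = true ↔ p = a ∧ q = b ∧ m = v) := by simp
    rcases hcases with ⟨A₁, A₂, rfl, rfl, rfl⟩ | ⟨B₁, B₂, rfl, rfl, rfl⟩ | ⟨rfl, rfl⟩
    · have h₁ := h A₁ (A₂ ++ (b₁ ++ Act.send p q m :: b₂) :: B) (by simp) a b v
      simp [deviationBlocks, hflat, -List.map_flatten, List.count_append,
        count_send_map_liftAct, count_recv_map_liftAct] at h₁ ⊢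
      omega
    · have h₁ := h (A ++ (b₁ ++ Act.send p q m :: b₂) :: B₁) B₂ (by simp) a b v
      by_cases hpq : p = a ∧ q = b ∧ m = v
      · obtain ⟨rfl, rfl, rfl⟩ := hpq
        simp [hflat, -List.map_flatten, List.count_append,
          count_send_map_liftAct, count_recv_map_liftAct] at h₁ hc ⊢
        omega
      · simp [hflat, -List.map_flatten, List.count_append, hpq,
          count_send_map_liftAct, count_recv_map_liftAct] at h₁ ⊢
        omega
    · have h₁ := h (A ++ (b₁ ++ Act.send p q m :: b₂) :: B) [] (by simp) a b v
      by_cases hpq : p = a ∧ q = b ∧ m = v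
      · obtain ⟨rfl, rfl, rfl⟩ := hpq
        simp [deviationBlocks, hflat, -List.map_flatten, List.count_append,
          count_send_map_liftAct, count_recv_map_liftAct] at h₁ hc ⊢
        omega
      · simp [deviationBlocks, hflat, -List.map_flatten, List.count_append, hpq,
          count_send_map_liftAct, count_recv_map_liftAct] at h₁ ⊢
        omega
  · rcases hcases with ⟨A₁, A₂, rfl, rfl, rfl⟩ | ⟨B₁, B₂, rfl, rfl, rfl⟩ | ⟨rfl, rfl⟩
    · simp [hflat, -List.map_flatten, hzero]
    · simp [hflat, -List.map_flatten, List.count_append, List.count_cons, hzero]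
    · simp [deviationBlocks, hflat, -List.map_flatten, List.count_append, List.count_cons, hzero]

omit [DecidableEq P] [DecidableEq M] in
theorem IsBlock.map_liftAct {k : ℕ} {b : List (Act P M)} (h : IsBlock k b) :
    IsBlock k (b.map liftAct) := by
  obtain ⟨ss, rs, rfl, hss, hrs, hs, hr⟩ := h
  refine ⟨ss.map liftAct, rs.map liftAct, by simp, ?_, ?_, by simpa, by simpa⟩
  · intro a' ha'
    obtain ⟨a, ha, rfl⟩ := List.mem_map.1 ha'
    have := hss a ha
    cases a <;> exact this
  · intro a' ha'
    obtain ⟨a, ha, rfl⟩ := List.mem_map.1 ha'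
    have := hrs a ha
    cases a <;> exact this

theorem isBlock_of_mem_deviationBlocks {k : ℕ} (hk : 1 ≤ k) {A B : List (List (Act P M))}
    {b₁ b₂ : List (Act P M)} {p q : P} {m : M}
    (hb : ∀ b ∈ A ++ (b₁ ++ Act.send p q m :: b₂) :: B, IsBlock k b)
    (h : BlockBalanced (A ++ (b₁ ++ Act.send p q m :: b₂) :: B))
    (hc : (A ++ (b₁ ++ Act.send p q m :: b₂) :: B).flatten.count (Act.recv p q m) =
      (A.flatten ++ b₁).count (Act.send p q m)) :
    ∀ b ∈ deviationBlocks A B b₁ b₂ p q m, IsBlock k b := by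
  intro b hmem
  simp only [deviationBlocks, List.mem_append, List.mem_cons, List.mem_map, List.not_mem_nil,
    or_false] at hmem
  rcases hmem with ⟨c, hcA, rfl⟩ | rfl | ⟨c, hcB, rfl⟩ | rfl
  · exact (hb c (by simp [hcA])).map_liftAct
  · obtain ⟨ss, rs, rfl, hb₁, hss, hrs, hlen⟩ := (hb (b₁ ++ Act.send p q m :: b₂)
      (by simp)).exists_of_send
    have hle : rs.length ≤ (b₁ ++ ss).length := by
      refine length_le_of_count_recv_le hrs fun p' q' m' => ?_
      have h₁ := h A _ rfl p' q' m'
      have h₂ := h (A ++ [b₁ ++ Act.send p q m :: (ss ++ rs)]) B (by simp) p' q' m'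
      have h₃ := count_recv_eq_zero_of_isSend hb₁ p' q' m'
      have h₄ := count_recv_eq_zero_of_isSend hss p' q' m'
      have h₅ := count_send_eq_zero_of_isRecv hrs p' q' m'
      by_cases hpq : p = p' ∧ q = q' ∧ m = m'
      · obtain ⟨rfl, rfl, rfl⟩ := hpq
        simp [List.count_append] at h₁ h₂ hc ⊢
        omega
      · simp [List.count_append, hpq] at h₁ h₂ ⊢
        omega
    rw [List.length_append] at hle
    refine ⟨b₁.map liftAct ++ Act.send (some p) none (Sum.inr (q, m)) :: ss.map liftAct,
      rs.map liftAct ++ [Act.recv (some p) none (Sum.inr (q, m))], by simp, ?_, ?_, ?_, ?_⟩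
    · intro a ha
      simp only [List.mem_append, List.mem_cons, List.mem_map] at ha
      rcases ha with ⟨c, hc, rfl⟩ | rfl | ⟨c, hc, rfl⟩
      · have := hb₁ c hc
        cases c <;> exact this
      · trivial
      · have := hss c hc
        cases c <;> exact this
    · intro a ha
      simp only [List.mem_append, List.mem_singleton, List.mem_map] at ha
      rcases ha with ⟨c, hc, rfl⟩ | rfl
      · have := hrs c hc
        cases c <;> exact this
      · trivial
    · simp; omega
    · simp; omega
  · exact (hb c (by simp [hcB])).map_liftAct
  · exact isBlock_pair hk _ _ _ _ _ _

theorem p2pKSyncSeq_deviation {k : ℕ} (hk : 1 ≤ k) {S : CSystem P M St} {e₁ e₂ : List (Act P M)}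
    {p q : P} {m : M} (h : p2pAsEx S (e₁ ++ Act.send p q m :: e₂ ++ [Act.recv p q m]))
    (hpq : receivedOn p q (e₁ ++ e₂) = sentOn p q e₁)
    (hsync : P2PKSyncSeq k (e₁ ++ Act.send p q m :: e₂)) :
    P2PKSyncSeq k (deviation e₁ e₂ p q m) := by
  obtain ⟨es, hb, hbal, hp⟩ := h.of_append.p2pKSyncSeq_iff.1 hsync
  obtain ⟨A, B, b₁, b₂, rfl, h₁, h₂⟩ : ∃ A B b₁ b₂, es = A ++ (b₁ ++ Act.send p q m :: b₂) :: B ∧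
      procProj p (A.flatten ++ b₁) = procProj p e₁ ∧
      procProj p (b₂ ++ B.flatten) = procProj p e₂ := by
    have hp' : es.flatten.filter (fun a => a.proc = p) =
        procProj p e₁ ++ Act.send p q m :: procProj p e₂ := by
      have := hp p
      rwa [procProj_append, procProj_cons_send, if_pos rfl] at this
    obtain ⟨F₁, F₂, hF, h₁, h₂⟩ := List.eq_append_cons_of_filter_eq hp'
    rcases List.flatten_eq_append_iff.1 hF with ⟨A, B, rfl, rfl, hB⟩ |
      ⟨A, b₁, c, b₂, B, rfl, rfl, hB⟩
    · obtain ⟨B₁, b₂, B₂, rfl, hB₁, rfl⟩ := List.flatten_eq_cons_iff.1 hB.symm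
      have hB₁' : B₁.flatten = [] := List.flatten_eq_nil_iff.2 hB₁
      exact ⟨A ++ B₁, B₂, [], b₂, by simp,
        by rwa [List.flatten_append, hB₁', List.append_nil, List.append_nil], h₂⟩
    · obtain ⟨rfl, rfl⟩ := List.cons.inj hB
      exact ⟨A, B, b₁, b₂, rfl, h₁, h₂⟩
  have hc : (A ++ (b₁ ++ Act.send p q m :: b₂) :: B).flatten.count (Act.recv p q m) =
      (A.flatten ++ b₁).count (Act.send p q m) := by
    have := congrArg (List.count m) hpq
    rw [count_receivedOn, count_sentOn, List.count_append] at this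
    rw [count_eq_of_procProj_eq (hp _), count_eq_of_procProj_eq (a := Act.send p q m) h₁,
      ← this, List.count_append, List.count_cons]
    simp
  refine (p2pAsEx_deviation h hpq).p2pKSyncSeq_iff.2 ⟨deviationBlocks A B b₁ b₂ p q m,
    isBlock_of_mem_deviationBlocks hk hb hbal hc, hbal.deviate hc, ?_⟩
  have hflat : (deviationBlocks A B b₁ b₂ p q m).flatten =
      (A.flatten ++ b₁).map liftAct ++ Act.send (some p) none (Sum.inr (q, m)) ::
        (b₂.map liftAct ++ Act.recv (some p) none (Sum.inr (q, m)) :: (B.flatten.map liftAct ++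
          [Act.send none (some q) (Sum.inl m), Act.recv none (some q) (Sum.inl m)])) := by
    simp [deviationBlocks, List.map_flatten]
  rw [hflat, deviation]
  rintro (_ | r)
  · simp only [procProj_append, procProj_cons_send, procProj_cons_recv, procProj_none_map_liftAct, procProj_nil]
    simp
  · simp only [procProj_append, procProj_cons_send, procProj_cons_recv, procProj_some_map_liftAct, procProj_nil]
    by_cases hr : p = r
    · subst hr
      have h₁' := congrArg (List.map (liftAct : Act P M → IAct P M)) h₁
      have h₂' := congrArg (List.map (liftAct : Act P M → IAct P M)) h₂
      simp only [procProj_append, List.map_append] at h₁' h₂'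
      simp [h₁', ← h₂']
    · have := congrArg (List.map (liftAct : Act P M → IAct P M)) (hp r)
      simp [procProj_append, procProj_cons_send, hr] at this ⊢
      simp only [← List.append_assoc] at this ⊢
      rw [this]

end DeviationBlocks

/-! ## Statement 16: a peer-to-peer system `S` is not k-synchronizable iff `S'` has a
k-synchronizable execution that is feasible and bad. -/

theorem p2p_not_ksynchronizable_iff_feasible_bad
    {P M St : Type} [Fintype P] [DecidableEq P] [Fintype M] [DecidableEq M] [Fintype St]
    (k : ℕ) (hk : 1 ≤ k) (S : CSystem P M St) :
    ¬ P2PKSynchronizable k S ↔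
      ∃ e' : List (IAct P M), p2pAsEx (instrumented S) e' ∧ P2PKSyncSeq k e' ∧
        P2PFeasible S e' ∧ P2PBadExec k S e' := by
  constructor
  · intro h
    obtain ⟨e, he, hns⟩ : ∃ e, p2pAsEx S e ∧ ¬ P2PKSyncSeq k e := by
      simpa [P2PKSynchronizable] using h
    obtain ⟨x, a, hx, hsync, hns⟩ : ∃ x a, p2pAsEx S (x ++ [a]) ∧ P2PKSyncSeq k x ∧
        ¬ P2PKSyncSeq k (x ++ [a]) := by
      induction e using List.reverseRecOn with
      | nil =>
        exact absurd (he.p2pKSyncSeq_iff.2 ⟨[], by simp, by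
          intro A B hAB
          obtain ⟨rfl, rfl⟩ := List.append_eq_nil_iff.1 hAB.symm
          simp, fun _ => rfl⟩) hns
      | append_singleton x a ih =>
        by_cases hx : P2PKSyncSeq k x
        · exact ⟨x, a, he, hx, hns⟩
        · exact ih he.of_append hx
    cases a with
    | send p q m => exact absurd (p2pKSyncSeq_concat_send hk hx hsync) hns
    | recv p q m =>
      obtain ⟨i, hm⟩ := hx.isFIFO.prefixBalanced.wfSeq x.length p q m (by simp)
      have hm' := hm
      obtain ⟨hlt, -, p', q', m', hs, hr, -⟩ := hm'
      rw [List.getElem?_concat_length, Option.some.injEq] at hr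
      injection hr with h₁ h₂ h₃
      subst h₁ h₂ h₃
      have hpq := (hx.isFIFO.receivedOn_take_eq hm hs).2
      rw [List.getElem?_append_left hlt] at hs
      obtain ⟨e₁, e₂, rfl, rfl⟩ : ∃ e₁ e₂, x = e₁ ++ Act.send p q m :: e₂ ∧ e₁.length = i :=
        ⟨_, _, List.eq_take_append_cons_drop hs, by simp; omega⟩
      have hpq : receivedOn p q (e₁ ++ e₂) = sentOn p q e₁ := by
        rw [List.take_of_length_le (by simp +arith), List.append_assoc,
          List.take_length_add_append] at hpq
        simp only [receivedOn_append, List.cons_append, receivedOn_cons_send,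
          receivedOn_cons_recv, and_self, if_true, receivedOn_nil, List.take_succ_cons,
          List.take_zero, sentOn_append, sentOn_cons_send, sentOn_nil, ← List.append_assoc] at hpq
        simpa using List.append_cancel_right hpq
      have hdev : Deviate (deviation e₁ e₂ p q m)
          (e₁ ++ Act.send p q m :: e₂ ++ [Act.recv p q m]) := by
        refine ⟨e₁, e₂, p, q, m, by simp, ?_, rfl⟩
        simpa using hm
      exact ⟨deviation e₁ e₂ p q m, p2pAsEx_deviation hx hpq,
        p2pKSyncSeq_deviation hk hx hpq hsync, ⟨_, hx, hdev⟩, ⟨_, hx, hdev, hns⟩⟩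
  · rintro ⟨-, -, -, -, ec, hec, -, hns⟩ h
    exact hns (h ec hec)
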